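/- arXiv:2403.17274 — 3 statements merged into one kernel-verified Lean document; each statement's English description precedes it below -/
import Mathlib

section
/- Let Φ be the root system of type G₂. Then a subset Σ ⊆ Φ⁺ is Worpitzky-compatible if and only if either Σ is negatively coclosed, or Σ = {α₂} ∪ S for some nonempty S ⊆ {2α₁+α₂, 3α₁+α₂, 3α₁+2α₂} (seven exceptional sets in total). -/
open scoped InnerProductSpace

noncomputable section

/-- Ambient Euclidean space `ℝ^ℓ` with the standard inner product. -/
abbrev EucV (ℓ : ℕ) : Type := EuclideanSpace ℝ (Fin ℓ)

variable {ℓ : ℕ}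

/-- `α` is a nonnegative integer combination of elements of `D`. -/
def IsNNIntComb (D : Set (EucV ℓ)) (α : EucV ℓ) : Prop :=
  ∃ (s : Finset (EucV ℓ)) (c : EucV ℓ → ℕ), (↑s : Set (EucV ℓ)) ⊆ D ∧
    α = ∑ b ∈ s, (c b : ℝ) • b

/-- Data of a reduced crystallographic root system `Φ` spanning `ℝ^ℓ`, together with a
fixed simple system `Δ` (every root is a nonnegative or nonpositive integer
combination of `Δ`). -/
structure RootSystemData (ℓ : ℕ) where
  Φ : Set (EucV ℓ)
  Δ : Set (EucV ℓ)
  finite : Φ.Finite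
  nonzero : (0 : EucV ℓ) ∉ Φ
  spanning : Submodule.span ℝ Φ = ⊤
  neg_mem : ∀ α ∈ Φ, -α ∈ Φ
  reduced : ∀ α ∈ Φ, ∀ t : ℝ, t • α ∈ Φ → t = 1 ∨ t = -1
  cryst : ∀ α ∈ Φ, ∀ β ∈ Φ, ∃ n : ℤ, 2 * ⟪β, α⟫_ℝ = (n : ℝ) * ⟪α, α⟫_ℝ
  refl_mem : ∀ α ∈ Φ, ∀ β ∈ Φ, β - (2 * ⟪β, α⟫_ℝ / ⟪α, α⟫_ℝ) • α ∈ Φ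
  simple_sub : Δ ⊆ Φ
  simple_indep : LinearIndependent ℝ (fun a : Δ => (a : EucV ℓ))
  pos_or_neg : ∀ α ∈ Φ, IsNNIntComb Δ α ∨ IsNNIntComb Δ (-α)

/-- A set of vectors is irreducible if it admits no decomposition into two nonempty
mutually orthogonal parts. -/
def IrredSet (S : Set (EucV ℓ)) : Prop :=
  ¬ ∃ S₁ S₂ : Set (EucV ℓ), S₁.Nonempty ∧ S₂.Nonempty ∧ S = S₁ ∪ S₂ ∧
      ∀ a ∈ S₁, ∀ b ∈ S₂, ⟪a, b⟫_ℝ = 0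

namespace RootSystemData

variable (rs : RootSystemData ℓ)

/-- The positive system `Φ⁺` determined by the simple system `Δ`. -/
def Pos : Set (EucV ℓ) := {α ∈ rs.Φ | IsNNIntComb rs.Δ α}

/-- `X` is a codimension-two intersection of reflecting hyperplanes of `Φ`. -/
def IsCodim2Flat (X : Set (EucV ℓ)) : Prop :=
  ∃ α ∈ rs.Pos, ∃ β ∈ rs.Pos, (¬ ∃ t : ℝ, β = t • α) ∧
    X = {x : EucV ℓ | ⟪α, x⟫_ℝ = 0 ∧ ⟪β, x⟫_ℝ = 0}

/-- The localization `Φ_X = Φ ∩ X^⊥`. -/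
def locΦ (X : Set (EucV ℓ)) : Set (EucV ℓ) := {γ ∈ rs.Φ | ∀ x ∈ X, ⟪γ, x⟫_ℝ = 0}

/-- The positive system `Φ⁺_X = Φ⁺ ∩ Φ_X` of the localization. -/
def locPos (X : Set (EucV ℓ)) : Set (EucV ℓ) := rs.Pos ∩ rs.locΦ X

/-- The (two-dimensional) linear span of the localization `Φ_X`, as a set. -/
def locSpan (X : Set (EucV ℓ)) : Set (EucV ℓ) :=
  (Submodule.span ℝ (rs.locΦ X) : Set (EucV ℓ))

end RootSystemData

/-- The indecomposable elements of a positive system `P`; for a positive system of a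
root (sub)system this is the associated simple system. -/
def simplesOf (P : Set (EucV ℓ)) : Set (EucV ℓ) :=
  {α ∈ P | ¬ ∃ β ∈ P, ∃ γ ∈ P, α = β + γ}

/-- The simple system `Δ_X` of the localization `Φ_X` associated to `Φ⁺_X`. -/
def RootSystemData.locΔ (rs : RootSystemData ℓ) (X : Set (EucV ℓ)) : Set (EucV ℓ) :=
  simplesOf (rs.locPos X)

/-- The union of the affine hyperplanes `H_α^n` (`α ∈ P`, `n ∈ ℤ`), traced on the
carrier set `U`. -/
def hypUnion (U P : Set (EucV ℓ)) : Set (EucV ℓ) :=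
  {x ∈ U | ∃ α ∈ P, ∃ n : ℤ, ⟪α, x⟫_ℝ = (n : ℝ)}

/-- `A` is an alcove: a connected component of the complement (in the carrier `U`)
of all the affine hyperplanes `H_α^n`, `α ∈ P`, `n ∈ ℤ`. -/
def IsAlcove (U P A : Set (EucV ℓ)) : Prop :=
  ∃ x ∈ U \ hypUnion U P, A = connectedComponentIn (U \ hypUnion U P) x

/-- `r` is the address of the alcove `A`: for each `γ ∈ P` and `x ∈ A` one has
`r γ - 1 < ⟪γ, x⟫ < r γ`. -/
def IsAddress (P A : Set (EucV ℓ)) (r : EucV ℓ → ℤ) : Prop :=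
  ∀ γ ∈ P, ∀ x ∈ A, ((r γ : ℝ) - 1 < ⟪γ, x⟫_ℝ ∧ ⟪γ, x⟫_ℝ < (r γ : ℝ))

/-- The upper closure `A^◊` of an alcove `A` with address `r`. -/
def upperClos (P A : Set (EucV ℓ)) (r : EucV ℓ → ℤ) : Set (EucV ℓ) :=
  {x ∈ closure A | ∀ γ ∈ P, (r γ : ℝ) - 1 < ⟪γ, x⟫_ℝ}

/-- The hyperplane `H_β^m` (traced on the carrier `U`) is a wall of the alcove `A`,
i.e. it supports a facet of `closure A`: its intersection with `closure A` affinely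
spans the whole trace of the hyperplane on `U`. -/
def IsWall (U : Set (EucV ℓ)) (β : EucV ℓ) (m : ℤ) (A : Set (EucV ℓ)) : Prop :=
  ∀ y ∈ U, ⟪β, y⟫_ℝ = (m : ℝ) →
    y ∈ affineSpan ℝ ({x ∈ U | ⟪β, x⟫_ℝ = (m : ℝ)} ∩ closure A)

/-- The fundamental parallelepiped `P^◊` determined by the simple system `D`,
traced on the carrier `U`. -/
def fundPar (U D : Set (EucV ℓ)) : Set (EucV ℓ) :=
  {x ∈ U | ∀ a ∈ D, 0 < ⟪a, x⟫_ℝ ∧ ⟪a, x⟫_ℝ ≤ 1}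

/-- Worpitzky-compatibility of `S` (inside carrier `U`, with positive system `P` and
simple system `D`): for every alcove `A ⊆ P^◊`, every `α ∈ S` and every `n ∈ ℤ`, the
intersection `A^◊ ∩ H_α^n` is empty or contained in a ceiling `H_β^m` of `A`
(a wall with `m = r(A,β) ≥ 1`) with `β ∈ S`. -/
def WCompat (U P D S : Set (EucV ℓ)) : Prop :=
  ∀ A : Set (EucV ℓ), IsAlcove U P A → A ⊆ fundPar U D →
    ∀ r : EucV ℓ → ℤ, IsAddress P A r →
      ∀ α ∈ S, ∀ n : ℤ,
        upperClos P A r ∩ {x : EucV ℓ | ⟪α, x⟫_ℝ = (n : ℝ)} = ∅ ∨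
        ∃ β ∈ S, ∃ m : ℤ, m = r β ∧ 1 ≤ m ∧ IsWall U β m A ∧
          upperClos P A r ∩ {x : EucV ℓ | ⟪α, x⟫_ℝ = (n : ℝ)} ⊆
            {x : EucV ℓ | ⟪β, x⟫_ℝ = (m : ℝ)}

/-- `S` is 2-locally (Worpitzky-)compatible: for every codimension-two flat `X` with
`Φ_X` irreducible, the localization `S ∩ Φ⁺_X` is Worpitzky-compatible in `Φ_X`,
inside the two-dimensional span of `Φ_X`, with respect to `Δ_X`. -/
def TwoLocallyCompat (rs : RootSystemData ℓ) (S : Set (EucV ℓ)) : Prop :=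
  ∀ X : Set (EucV ℓ), rs.IsCodim2Flat X → IrredSet (rs.locΦ X) →
    WCompat (rs.locSpan X) (rs.locPos X) (rs.locΔ X) (S ∩ rs.locPos X)

/-- `S` is 2-locally simple: for every codimension-two flat `X` with `Φ_X`
irreducible, either `S ∩ Φ⁺_X` contains a simple root of `Φ_X` or it is empty. -/
def TwoLocallySimple (rs : RootSystemData ℓ) (S : Set (EucV ℓ)) : Prop :=
  ∀ X : Set (EucV ℓ), rs.IsCodim2Flat X → IrredSet (rs.locΦ X) →
    ((S ∩ rs.locPos X) ∩ rs.locΔ X).Nonempty ∨ S ∩ rs.locPos X = ∅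

/-- `S` is negatively coclosed in the positive system `P`. -/
def NegCoclosed (P S : Set (EucV ℓ)) : Prop :=
  ∀ α ∈ S, ∀ β₁ ∈ P, ∀ β₂ ∈ P, ∀ d₁ d₂ : ℤ, 0 < d₁ → 0 < d₂ →
    α = (d₁ : ℝ) • β₁ + (d₂ : ℝ) • β₂ → ⟪β₁, β₂⟫_ℝ < 0 → β₁ ∈ S ∨ β₂ ∈ S

/-- `S` is coclosed in the positive system `P`. -/
def Coclosed (P S : Set (EucV ℓ)) : Prop :=
  ∀ α ∈ S, ∀ β₁ ∈ P, ∀ β₂ ∈ P, ∀ d₁ d₂ : ℤ, 0 < d₁ → 0 < d₂ →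
    α = (d₁ : ℝ) • β₁ + (d₂ : ℝ) • β₂ → β₁ ∈ S ∨ β₂ ∈ S

/-- The root order: `β ≤ γ` iff `γ - β` is a nonnegative integer combination of the
simple roots in `D`. -/
def rootLE (D : Set (EucV ℓ)) (β γ : EucV ℓ) : Prop := IsNNIntComb D (γ - β)

/-- The defining recursion (on `Φ⁺`) for the function `r` of Lemma 3.8, with respect
to `Δ_X = {γ₁, γ₂}`:
(i) `r β = 1` if `β ∈ Δ` or `β ≤ γ₁` or `β ≤ γ₂`;
(ii) if `β ∉ Δ`, `β ≰ γ₁`, `β ≰ γ₂` and `β - γᵢ ∈ Φ⁺` for `i = 1` or `2`, then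
`r β = r (β - γᵢ) + 1`;
(iii) otherwise `r β = max { r (β - α) : α ∈ Δ, β - α ∈ Φ⁺ }`. -/
def AddrSpec (rs : RootSystemData ℓ) (γ₁ γ₂ : EucV ℓ) (r : EucV ℓ → ℤ) : Prop :=
  (∀ β ∈ rs.Pos, (β ∈ rs.Δ ∨ rootLE rs.Δ β γ₁ ∨ rootLE rs.Δ β γ₂) → r β = 1) ∧
  (∀ β ∈ rs.Pos, β ∉ rs.Δ → ¬ rootLE rs.Δ β γ₁ → ¬ rootLE rs.Δ β γ₂ →
    ((β - γ₁ ∈ rs.Pos → r β = r (β - γ₁) + 1) ∧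
     (β - γ₂ ∈ rs.Pos → r β = r (β - γ₂) + 1))) ∧
  (∀ β ∈ rs.Pos, β ∉ rs.Δ → ¬ rootLE rs.Δ β γ₁ → ¬ rootLE rs.Δ β γ₂ →
    β - γ₁ ∉ rs.Pos → β - γ₂ ∉ rs.Pos →
    ∃ α ∈ rs.Δ, β - α ∈ rs.Pos ∧ r β = r (β - α) ∧
      ∀ α' ∈ rs.Δ, β - α' ∈ rs.Pos → r (β - α') ≤ r (β - α))

section Helpers

lemma slab_convex (P : Set (EucV ℓ)) (r : EucV ℓ → ℤ) :
    Convex ℝ {x : EucV ℓ | ∀ γ ∈ P, ((r γ : ℝ) - 1 < ⟪γ, x⟫_ℝ ∧ ⟪γ, x⟫_ℝ < (r γ : ℝ))} := by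
  intro x hx y hy a b ha hb hab γ hγ
  have h1 := hx γ hγ
  have h2 := hy γ hγ
  rw [inner_add_right, inner_smul_right, inner_smul_right]
  have hb' : b = 1 - a := by linarith
  subst hb'
  rcases eq_or_lt_of_le ha with h | h
  · subst h; constructor <;> linarith [h2.1, h2.2]
  · constructor
    · nlinarith [mul_lt_mul_of_pos_left h1.1 h, mul_le_mul_of_nonneg_left h2.1.le hb]
    · nlinarith [mul_lt_mul_of_pos_left h1.2 h, mul_le_mul_of_nonneg_left h2.2.le hb]

lemma alcove_eq {P A : Set (EucV ℓ)} {r : EucV ℓ → ℤ}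
    (hA : IsAlcove Set.univ P A) (hr : IsAddress P A r) :
    A = {x : EucV ℓ | ∀ γ ∈ P, ((r γ : ℝ) - 1 < ⟪γ, x⟫_ℝ ∧ ⟪γ, x⟫_ℝ < (r γ : ℝ))} := by
  apply Set.Subset.antisymm
  · intro x hx γ hγ
    exact hr γ hγ x hx
  · obtain ⟨c, hc, rfl⟩ := hA
    have hcA := mem_connectedComponentIn hc
    apply IsPreconnected.subset_connectedComponentIn (slab_convex P r).isPreconnected
    · intro γ hγ
      exact hr γ hγ c hcA
    · intro x hx
      refine ⟨trivial, ?_⟩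
      rintro ⟨-, α, hα, n, hn⟩
      have h := hx α hα
      rw [hn] at h
      have h1 : r α - 1 < n := by exact_mod_cast h.1
      have h2 : n < r α := by exact_mod_cast h.2
      omega

lemma closure_alcove {P A : Set (EucV ℓ)} {r : EucV ℓ → ℤ}
    (hA : IsAlcove Set.univ P A) (hr : IsAddress P A r) (y : EucV ℓ) :
    y ∈ closure A ↔ ∀ γ ∈ P, ((r γ : ℝ) - 1 ≤ ⟪γ, y⟫_ℝ ∧ ⟪γ, y⟫_ℝ ≤ (r γ : ℝ)) := by
  constructor
  · intro hy γ hγ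
    have hcl : IsClosed {x : EucV ℓ | (r γ : ℝ) - 1 ≤ ⟪γ, x⟫_ℝ ∧ ⟪γ, x⟫_ℝ ≤ (r γ : ℝ)} := by
      have c1 : Continuous (fun x : EucV ℓ => ⟪γ, x⟫_ℝ) := by fun_prop
      exact (isClosed_le continuous_const c1).inter (isClosed_le c1 continuous_const)
    have hsub : A ⊆ {x : EucV ℓ | (r γ : ℝ) - 1 ≤ ⟪γ, x⟫_ℝ ∧ ⟪γ, x⟫_ℝ ≤ (r γ : ℝ)} :=
      fun x hx => ⟨(hr γ hγ x hx).1.le, (hr γ hγ x hx).2.le⟩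
    exact closure_minimal hsub hcl hy
  · intro hy
    have hAe := alcove_eq hA hr
    obtain ⟨c, hc, hAc⟩ := hA
    have hcA : c ∈ A := by rw [hAc]; exact mem_connectedComponentIn hc
    have hmem : ∀ t : ℝ, t ∈ Set.Ioo (0:ℝ) 1 → y + t • (c - y) ∈ A := by
      intro t ht
      rw [hAe]
      intro γ hγ
      have h1 := hy γ hγ
      have h2 := hr γ hγ c hcA
      rw [inner_add_right, inner_smul_right, inner_sub_right]
      have h0 := ht.1
      have h0' : 0 < 1 - t := by linarith [ht.2]
      constructor
      · nlinarith [mul_lt_mul_of_pos_left h2.1 h0, mul_le_mul_of_nonneg_left h1.1 h0'.le]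
      · nlinarith [mul_lt_mul_of_pos_left h2.2 h0, mul_le_mul_of_nonneg_left h1.2 h0'.le]
    have hcont : Continuous (fun t : ℝ => y + t • (c - y)) := by fun_prop
    have h0 : (0:ℝ) ∈ closure (Set.Ioo (0:ℝ) 1) := by
      rw [closure_Ioo (by norm_num)]; simp
    have := map_mem_closure hcont h0 hmem
    simpa using this

lemma alcove_exists {P : Set (EucV ℓ)} (c : EucV ℓ) (hc : ∀ γ ∈ P, ∀ n : ℤ, ⟪γ, c⟫_ℝ ≠ n) :
    ∃ A, IsAlcove Set.univ P A ∧ c ∈ A ∧ IsAddress P A (fun γ => ⌈⟪γ, c⟫_ℝ⌉) := by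
  have hcm : c ∈ Set.univ \ hypUnion Set.univ P := by
    refine ⟨trivial, ?_⟩
    rintro ⟨-, α, hα, n, hn⟩
    exact hc α hα n hn
  refine ⟨connectedComponentIn (Set.univ \ hypUnion Set.univ P) c, ⟨c, hcm, rfl⟩,
    mem_connectedComponentIn hcm, ?_⟩
  intro γ hγ x hx
  have hpre : IsPreconnected
      ((fun z : EucV ℓ => ⟪γ, z⟫_ℝ) '' connectedComponentIn (Set.univ \ hypUnion Set.univ P) c) :=
    isPreconnected_connectedComponentIn.image _ (by fun_prop)
  have hoc := hpre.ordConnected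
  have hno : ∀ n : ℤ, (n : ℝ) ∉
      ((fun z : EucV ℓ => ⟪γ, z⟫_ℝ) '' connectedComponentIn (Set.univ \ hypUnion Set.univ P) c) := by
    rintro n ⟨z, hz, hzn⟩
    have := connectedComponentIn_subset _ _ hz
    exact this.2 ⟨trivial, γ, hγ, n, hzn⟩
  have hcI := Set.mem_image_of_mem (fun z : EucV ℓ => ⟪γ, z⟫_ℝ) (mem_connectedComponentIn hcm)
  have hxI := Set.mem_image_of_mem (fun z : EucV ℓ => ⟪γ, z⟫_ℝ) hx
  have h1 := Int.ceil_lt_add_one ⟪γ, c⟫_ℝ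
  have h2 := Int.le_ceil ⟪γ, c⟫_ℝ
  constructor
  · by_contra! hcon
    apply hno (⌈⟪γ, c⟫_ℝ⌉ - 1)
    apply hoc.out hxI hcI
    push_cast
    exact ⟨hcon, by linarith⟩
  · by_contra! hcon
    exact hno ⌈⟪γ, c⟫_ℝ⌉ (hoc.out hcI hxI ⟨h2, hcon⟩)

/-- A facet is spanned by two points of the closure. -/
lemma wall_of_pts {a1 a2 : EucV 2}
    (hinj : ∀ x y : EucV 2, ⟪a1, x⟫_ℝ = ⟪a1, y⟫_ℝ → ⟪a2, x⟫_ℝ = ⟪a2, y⟫_ℝ → x = y)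
    {A : Set (EucV 2)} {β : EucV 2} {m : ℤ} (b1 b2 : ℝ)
    (hβ : ∀ x, ⟪β, x⟫_ℝ = b1 * ⟪a1, x⟫_ℝ + b2 * ⟪a2, x⟫_ℝ)
    (p q : EucV 2) (hp : p ∈ closure A) (hq : q ∈ closure A)
    (hpm : ⟪β, p⟫_ℝ = m) (hqm : ⟪β, q⟫_ℝ = m)
    (hne : (b2 ≠ 0 ∧ ⟪a1, q⟫_ℝ - ⟪a1, p⟫_ℝ ≠ 0) ∨ (b1 ≠ 0 ∧ ⟪a2, q⟫_ℝ - ⟪a2, p⟫_ℝ ≠ 0)) :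
    IsWall Set.univ β m A := by
  intro y _ hy
  have key : ∃ t : ℝ, y = AffineMap.lineMap p q t := by
    rw [hβ] at hy hpm hqm
    rcases hne with ⟨hb, hd⟩ | ⟨hb, hd⟩
    · refine ⟨(⟪a1, y⟫_ℝ - ⟪a1, p⟫_ℝ) / (⟪a1, q⟫_ℝ - ⟪a1, p⟫_ℝ), hinj _ _ ?_ ?_⟩
      · rw [AffineMap.lineMap_apply_module', inner_add_right, inner_smul_right, inner_sub_right]
        field_simp
        ring
      · rw [AffineMap.lineMap_apply_module', inner_add_right, inner_smul_right, inner_sub_right]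
        field_simp
        apply mul_left_cancel₀ hb
        linear_combination (⟪a1, q⟫_ℝ - ⟪a1, p⟫_ℝ) * (hy - hpm) - (⟪a1, y⟫_ℝ - ⟪a1, p⟫_ℝ) * (hqm - hpm)
    · refine ⟨(⟪a2, y⟫_ℝ - ⟪a2, p⟫_ℝ) / (⟪a2, q⟫_ℝ - ⟪a2, p⟫_ℝ), hinj _ _ ?_ ?_⟩
      · rw [AffineMap.lineMap_apply_module', inner_add_right, inner_smul_right, inner_sub_right]
        field_simp
        apply mul_left_cancel₀ hb
        linear_combination (⟪a2, q⟫_ℝ - ⟪a2, p⟫_ℝ) * (hy - hpm) - (⟪a2, y⟫_ℝ - ⟪a2, p⟫_ℝ) * (hqm - hpm)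
      · rw [AffineMap.lineMap_apply_module', inner_add_right, inner_smul_right, inner_sub_right]
        field_simp
        ring
  obtain ⟨t, rfl⟩ := key
  exact AffineMap.lineMap_mem t (subset_affineSpan ℝ _ ⟨⟨trivial, hpm⟩, hp⟩)
    (subset_affineSpan ℝ _ ⟨⟨trivial, hqm⟩, hq⟩)

lemma not_wall {A : Set (EucV 2)} {β : EucV 2} {m : ℤ} (p w : EucV 2) (hw : w ≠ 0)
    (hβw : ⟪β, w⟫_ℝ = 0) (hpm : ⟪β, p⟫_ℝ = m)
    (hsub : ∀ x ∈ closure A, ⟪β, x⟫_ℝ = m → x = p) : ¬ IsWall Set.univ β m A := by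
  intro h
  have h1 := h (p + w) trivial (by rw [inner_add_right, hβw, hpm, add_zero])
  have h2 : ({x ∈ Set.univ | ⟪β, x⟫_ℝ = (m : ℝ)} ∩ closure A) ⊆ {p} := by
    rintro x ⟨⟨-, hx⟩, hxA⟩
    exact hsub x hxA hx
  have h3 := affineSpan_mono ℝ h2 h1
  rw [AffineSubspace.mem_affineSpan_singleton] at h3
  exact hw (by simpa using h3)

end Helpers

/-- Coordinate inequalities. -/
def Cl6 (R0 R1 R2 R3 R4 R5 : ℤ) (u v : ℝ) : Prop :=
  ((R0 : ℝ) - 1 ≤ u ∧ u ≤ R0) ∧ ((R1 : ℝ) - 1 ≤ v ∧ v ≤ R1) ∧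
  ((R2 : ℝ) - 1 ≤ u + v ∧ u + v ≤ R2) ∧ ((R3 : ℝ) - 1 ≤ 2 * u + v ∧ 2 * u + v ≤ R3) ∧
  ((R4 : ℝ) - 1 ≤ 3 * u + v ∧ 3 * u + v ≤ R4) ∧
  ((R5 : ℝ) - 1 ≤ 3 * u + 2 * v ∧ 3 * u + 2 * v ≤ R5)

/-- Coordinate inequalities. -/
def Up6 (R0 R1 R2 R3 R4 R5 : ℤ) (u v : ℝ) : Prop :=
  ((R0 : ℝ) - 1 < u ∧ u ≤ R0) ∧ ((R1 : ℝ) - 1 < v ∧ v ≤ R1) ∧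
  ((R2 : ℝ) - 1 < u + v ∧ u + v ≤ R2) ∧ ((R3 : ℝ) - 1 < 2 * u + v ∧ 2 * u + v ≤ R3) ∧
  ((R4 : ℝ) - 1 < 3 * u + v ∧ 3 * u + v ≤ R4) ∧
  ((R5 : ℝ) - 1 < 3 * u + 2 * v ∧ 3 * u + 2 * v ≤ R5)

lemma alcove_list (R0 R1 R2 R3 R4 R5 : ℤ) (u v : ℝ) (hu : 0 < u) (hu1 : u ≤ 1) (hv : 0 < v)
    (hv1 : v ≤ 1)
    (h0 : (R0 : ℝ) - 1 < u ∧ u < R0) (h1 : (R1 : ℝ) - 1 < v ∧ v < R1)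
    (h2 : (R2 : ℝ) - 1 < u + v ∧ u + v < R2) (h3 : (R3 : ℝ) - 1 < 2 * u + v ∧ 2 * u + v < R3)
    (h4 : (R4 : ℝ) - 1 < 3 * u + v ∧ 3 * u + v < R4)
    (h5 : (R5 : ℝ) - 1 < 3 * u + 2 * v ∧ 3 * u + 2 * v < R5) :
    R0 = 1 ∧ R1 = 1 ∧
    ((R2 = 1 ∧ R3 = 1 ∧ R4 = 1 ∧ R5 = 1) ∨ (R2 = 1 ∧ R3 = 1 ∧ R4 = 1 ∧ R5 = 2) ∨
     (R2 = 1 ∧ R3 = 1 ∧ R4 = 2 ∧ R5 = 2) ∨ (R2 = 1 ∧ R3 = 2 ∧ R4 = 2 ∧ R5 = 2) ∨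
     (R2 = 1 ∧ R3 = 2 ∧ R4 = 2 ∧ R5 = 3) ∨ (R2 = 1 ∧ R3 = 2 ∧ R4 = 3 ∧ R5 = 3) ∨
     (R2 = 2 ∧ R3 = 2 ∧ R4 = 2 ∧ R5 = 3) ∨ (R2 = 2 ∧ R3 = 2 ∧ R4 = 3 ∧ R5 = 3) ∨
     (R2 = 2 ∧ R3 = 2 ∧ R4 = 3 ∧ R5 = 4) ∨ (R2 = 2 ∧ R3 = 3 ∧ R4 = 3 ∧ R5 = 4) ∨
     (R2 = 2 ∧ R3 = 3 ∧ R4 = 4 ∧ R5 = 4) ∨ (R2 = 2 ∧ R3 = 3 ∧ R4 = 4 ∧ R5 = 5)) := by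
  have e1 : 0 < R0 := by exact_mod_cast (by linarith : (0:ℝ) < R0)
  have e2 : R0 < 2 := by exact_mod_cast (by linarith : (R0:ℝ) < 2)
  have e3 : 0 < R1 := by exact_mod_cast (by linarith : (0:ℝ) < R1)
  have e4 : R1 < 2 := by exact_mod_cast (by linarith : (R1:ℝ) < 2)
  obtain rfl : R0 = 1 := by omega
  obtain rfl : R1 = 1 := by omega
  push_cast at h0 h1
  -- linear relations between the integers
  have f1 : 0 < R2 := by exact_mod_cast (by linarith : (0:ℝ) < R2)
  have f2 : R2 < 3 := by exact_mod_cast (by linarith : (R2:ℝ) < 3)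
  have f3 : R3 < R2 + 2 := by exact_mod_cast (by linarith : (R3:ℝ) < R2 + 2)
  have f4 : R2 < R3 + 1 := by exact_mod_cast (by linarith : (R2:ℝ) < R3 + 1)
  have f5 : R4 < R3 + 2 := by exact_mod_cast (by linarith : (R4:ℝ) < R3 + 2)
  have f6 : R3 < R4 + 1 := by exact_mod_cast (by linarith : (R3:ℝ) < R4 + 1)
  have f7 : R5 < R4 + 2 := by exact_mod_cast (by linarith : (R5:ℝ) < R4 + 2)
  have f8 : R4 < R5 + 1 := by exact_mod_cast (by linarith : (R4:ℝ) < R5 + 1)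
  have f9 : R5 < R2 + R3 + 1 := by exact_mod_cast (by linarith : (R5:ℝ) < R2 + R3 + 1)
  have f10 : R2 + R3 < R5 + 2 := by exact_mod_cast (by linarith : (R2:ℝ) + R3 < R5 + 2)
  have f11 : R4 + R2 < 2 * R3 + 2 := by exact_mod_cast (by linarith : (R4:ℝ) + R2 < 2 * R3 + 2)
  have f12 : 2 * R3 < R4 + R2 + 2 := by exact_mod_cast (by linarith : 2 * (R3:ℝ) < R4 + R2 + 2)
  have f13 : R4 < 2 + R2 + 1 := by exact_mod_cast (by linarith : (R4:ℝ) < 2 + R2 + 1)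
  have f14 : 2 * R5 < 3 * R2 + R4 + 2 := by
    exact_mod_cast (by linarith : 2 * (R5:ℝ) < 3 * R2 + R4 + 2)
  have f15 : 3 * R2 + R4 < 2 * R5 + 4 := by
    exact_mod_cast (by linarith : 3 * (R2:ℝ) + R4 < 2 * R5 + 4)
  have f16 : 2 * R5 < 3 * R3 + 1 + 2 := by
    exact_mod_cast (by linarith : 2 * (R5:ℝ) < 3 * R3 + 1 + 2)
  have f17 : 3 * R3 < 2 * R5 + 3 := by
    exact_mod_cast (by linarith : 3 * (R3:ℝ) < 2 * R5 + 3)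
  refine ⟨rfl, rfl, ?_⟩
  clear h0 h1 h2 h3 h4 h5
  have g2 : R2 = 1 ∨ R2 = 2 := by omega
  have g3 : R3 = R2 ∨ R3 = R2 + 1 := by omega
  have g4 : R4 = R3 ∨ R4 = R3 + 1 := by omega
  have g5 : R5 = R4 ∨ R5 = R4 + 1 := by omega
  rcases g2 with rfl | rfl <;> rcases g3 with rfl | rfl <;> rcases g4 with rfl | rfl <;>
    rcases g5 with rfl | rfl <;> first | (exfalso; omega) | norm_num

set_option maxHeartbeats 1000000 in
lemma g2_setup
    (rs : RootSystemData 2) (a1 a2 : EucV 2)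
    (hΔ : rs.Δ = {a1, a2}) (hlen : ⟪a1, a1⟫_ℝ < ⟪a2, a2⟫_ℝ)
    (hPos : rs.Pos = {a1, a2, a1 + a2, (2:ℝ) • a1 + a2, (3:ℝ) • a1 + a2,
      (3:ℝ) • a1 + (2:ℝ) • a2})
    : (0 < ⟪a1, a1⟫_ℝ) ∧ (∀ s t : ℝ, s • a1 + t • a2 = 0 → s = 0 ∧ t = 0) ∧
      (⟪a1, a2⟫_ℝ = -(3 / 2) * ⟪a1, a1⟫_ℝ) ∧ (⟪a2, a1⟫_ℝ = -(3 / 2) * ⟪a1, a1⟫_ℝ) ∧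
      (⟪a2, a2⟫_ℝ = 3 * ⟪a1, a1⟫_ℝ) ∧
      (∀ x y : EucV 2, ⟪a1, x⟫_ℝ = ⟪a1, y⟫_ℝ → ⟪a2, x⟫_ℝ = ⟪a2, y⟫_ℝ → x = y) ∧
      (∀ u v : ℝ, ∃ x : EucV 2, ⟪a1, x⟫_ℝ = u ∧ ⟪a2, x⟫_ℝ = v) := by
  -- basic facts
  have hne12 : a1 ≠ a2 := by
    rintro rfl
    exact lt_irrefl _ hlen
  have ha1 : a1 ∈ rs.Φ := rs.simple_sub (by rw [hΔ]; simp)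
  have ha2 : a2 ∈ rs.Φ := rs.simple_sub (by rw [hΔ]; simp)
  have ha10 : a1 ≠ 0 := fun h => rs.nonzero (h ▸ ha1)
  have hApos : 0 < ⟪a1, a1⟫_ℝ := real_inner_self_pos.mpr ha10
  have hind : ∀ s t : ℝ, s • a1 + t • a2 = 0 → s = 0 ∧ t = 0 := by
    have h := rs.simple_indep
    rw [hΔ] at h
    exact (LinearIndepOn.pair_iff (R := ℝ) id hne12).mp h
  have hroot : ∀ c d : ℝ, c • a1 + d • a2 ∈ rs.Φ →
      ∃ e : ℝ, (e = 1 ∨ e = -1) ∧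
        ((c = e ∧ d = 0) ∨ (c = 0 ∧ d = e) ∨ (c = e ∧ d = e) ∨ (c = 2 * e ∧ d = e) ∨
          (c = 3 * e ∧ d = e) ∨ (c = 3 * e ∧ d = 2 * e)) := by
    intro c d h
    have hp : ∃ e : ℝ, (e = 1 ∨ e = -1) ∧ e • (c • a1 + d • a2) ∈ rs.Pos := by
      rcases rs.pos_or_neg _ h with h' | h'
      · exact ⟨1, Or.inl rfl, by rw [one_smul]; exact ⟨h, h'⟩⟩
      · exact ⟨-1, Or.inr rfl, by rw [neg_one_smul]; exact ⟨rs.neg_mem _ h, h'⟩⟩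
    obtain ⟨e, he, hm⟩ := hp
    refine ⟨e, he, ?_⟩
    rw [hPos] at hm
    have key : ∀ k l : ℝ, e • (c • a1 + d • a2) = k • a1 + l • a2 → c = k * e ∧ d = l * e := by
      intro k l hkl
      have := hind (e * c - k) (e * d - l) (by
        have h2 := sub_eq_zero.mpr hkl
        rw [← h2]; module)
      rcases he with rfl | rfl <;> constructor <;> linarith [this.1, this.2]
    simp only [Set.mem_insert_iff, Set.mem_singleton_iff] at hm
    rcases hm with hm | hm | hm | hm | hm | hm
    · have := key 1 0 (by rw [hm]; module)
      left; constructor <;> linarith [this.1, this.2]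
    · have := key 0 1 (by rw [hm]; module)
      right; left; constructor <;> linarith [this.1, this.2]
    · have := key 1 1 (by rw [hm]; module)
      right; right; left; constructor <;> linarith [this.1, this.2]
    · have := key 2 1 (by rw [hm]; module)
      right; right; right; left; constructor <;> linarith [this.1, this.2]
    · have := key 3 1 (by rw [hm]; module)
      right; right; right; right; left; constructor <;> linarith [this.1, this.2]
    · have := key 3 2 hm
      right; right; right; right; right; constructor <;> linarith [this.1, this.2]
  have hposΦ : ∀ α ∈ rs.Pos, α ∈ rs.Φ := fun α h => h.1
  -- the Cartan integers
  have hG12 : ⟪a1, a2⟫_ℝ = -(3 / 2) * ⟪a1, a1⟫_ℝ := by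
    obtain ⟨n, hn⟩ := rs.cryst a1 ha1 a2 ha2
    have hq : 2 * ⟪a2, a1⟫_ℝ / ⟪a1, a1⟫_ℝ = n := by rw [hn]; field_simp
    have hq' : 2 * ⟪(3:ℝ) • a1 + a2, a1⟫_ℝ / ⟪a1, a1⟫_ℝ = 6 + n := by
      rw [inner_add_left, real_inner_smul_left, mul_add, hn]; field_simp; ring
    have h1 := rs.refl_mem a1 ha1 a2 ha2
    have h2 := rs.refl_mem a1 ha1 ((3:ℝ) • a1 + a2) (hposΦ _ (by rw [hPos]; simp))
    rw [hq] at h1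
    rw [hq'] at h2
    obtain ⟨e, he, h1⟩ := hroot (-n) 1 (by convert h1 using 1; module)
    obtain ⟨e', he', h2⟩ := hroot (-3 - n) 1 (by convert h2 using 1; module)
    have hge : (n:ℝ) ≥ -3 := by
      rcases he with rfl | rfl <;>
      rcases h1 with h | h | h | h | h | h <;> linarith [h.1, h.2]
    have hle : (n:ℝ) ≤ -3 := by
      rcases he' with rfl | rfl <;>
      rcases h2 with h | h | h | h | h | h <;> linarith [h.1, h.2]
    have hn3 : (n:ℝ) = -3 := le_antisymm hle hge
    rw [hn3, real_inner_comm] at hn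
    linarith
  have hG22 : ⟪a2, a2⟫_ℝ = 3 * ⟪a1, a1⟫_ℝ := by
    obtain ⟨n, hn⟩ := rs.cryst a2 ha2 a1 ha1
    have hB : 0 < ⟪a2, a2⟫_ℝ := hApos.trans hlen
    have hq : 2 * ⟪a1, a2⟫_ℝ / ⟪a2, a2⟫_ℝ = n := by rw [hn]; field_simp
    have h1 := rs.refl_mem a2 ha2 a1 ha1
    rw [hq] at h1
    obtain ⟨e, he, h1⟩ := hroot 1 (-n) (by convert h1 using 1; module)
    rw [hG12] at hn
    have hn1 : (n:ℝ) = 0 ∨ (n:ℝ) = -1 := by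
      rcases he with rfl | rfl <;>
      rcases h1 with h | h | h | h | h | h <;>
      first
        | (exfalso; linarith [h.1, h.2])
        | (left; linarith [h.1, h.2])
        | (right; linarith [h.1, h.2])
    rcases hn1 with h | h <;> rw [h] at hn <;> linarith
  have hG21 : ⟪a2, a1⟫_ℝ = -(3 / 2) * ⟪a1, a1⟫_ℝ := by rw [real_inner_comm]; exact hG12
  -- coordinates
  have hinj : ∀ x y : EucV 2, ⟪a1, x⟫_ℝ = ⟪a1, y⟫_ℝ → ⟪a2, x⟫_ℝ = ⟪a2, y⟫_ℝ → x = y := by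
    intro x y h1 h2
    have hz : ∀ w : EucV 2, ⟪w, x - y⟫_ℝ = 0 := by
      have hb : ∀ b ∈ rs.Δ, ⟪b, x - y⟫_ℝ = 0 := by
        rw [hΔ]
        rintro b (rfl | rfl) <;> rw [inner_sub_right] <;> linarith
      have hc : ∀ α, IsNNIntComb rs.Δ α → ⟪α, x - y⟫_ℝ = 0 := by
        rintro α ⟨s, c, hs, rfl⟩
        rw [sum_inner]
        apply Finset.sum_eq_zero
        intro b hb'
        rw [real_inner_smul_left, hb b (hs hb'), mul_zero]
      intro w
      have hw : w ∈ Submodule.span ℝ rs.Φ := by rw [rs.spanning]; trivial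
      induction hw using Submodule.span_induction with
      | mem α hα =>
        rcases rs.pos_or_neg α hα with h | h
        · exact hc α h
        · have := hc _ h
          rw [inner_neg_left] at this
          linarith
      | zero => simp
      | add a b _ _ ha hb => rw [inner_add_left, ha, hb, add_zero]
      | smul t a _ ha => rw [real_inner_smul_left, ha, mul_zero]
    exact sub_eq_zero.mp (inner_self_eq_zero.mp (hz (x - y)))
  have hsur : ∀ u v : ℝ, ∃ x : EucV 2, ⟪a1, x⟫_ℝ = u ∧ ⟪a2, x⟫_ℝ = v := by
    intro u v
    refine ⟨((4 * u + 2 * v) / ⟪a1, a1⟫_ℝ) • a1 + ((2 * u + 4 / 3 * v) / ⟪a1, a1⟫_ℝ) • a2, ?_, ?_⟩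
    · rw [inner_add_right, inner_smul_right, inner_smul_right, hG12]
      field_simp; ring
    · rw [inner_add_right, inner_smul_right, inner_smul_right, hG21, hG22]
      field_simp; ring
  exact ⟨hApos, hind, hG12, hG21, hG22, hinj, hsur⟩

set_option maxHeartbeats 1000000 in
lemma g2_neg
    (rs : RootSystemData 2) (a1 a2 : EucV 2)
    (hΔ : rs.Δ = {a1, a2}) (hlen : ⟪a1, a1⟫_ℝ < ⟪a2, a2⟫_ℝ)
    (hPos : rs.Pos = {a1, a2, a1 + a2, (2:ℝ) • a1 + a2, (3:ℝ) • a1 + a2,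
      (3:ℝ) • a1 + (2:ℝ) • a2})
    (S : Set (EucV 2)) (hS : S ⊆ rs.Pos) :
    NegCoclosed rs.Pos S ↔
      ((a1 + a2 ∈ S ∨ (2:ℝ) • a1 + a2 ∈ S ∨ (3:ℝ) • a1 + a2 ∈ S ∨ (3:ℝ) • a1 + (2:ℝ) • a2 ∈ S →
          a1 ∈ S ∨ a2 ∈ S) ∧
       ((2:ℝ) • a1 + a2 ∈ S ∨ (3:ℝ) • a1 + a2 ∈ S ∨ (3:ℝ) • a1 + (2:ℝ) • a2 ∈ S →
          a1 ∈ S ∨ a1 + a2 ∈ S) ∧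
       ((3:ℝ) • a1 + (2:ℝ) • a2 ∈ S → a2 ∈ S ∨ (3:ℝ) • a1 + a2 ∈ S)) := by
  obtain ⟨hApos, hind, hG12, hG21, hG22, hinj, hsur⟩ := g2_setup rs a1 a2 hΔ hlen hPos
  have m0 : a1 ∈ rs.Pos := by rw [hPos]; simp
  have m1 : a2 ∈ rs.Pos := by rw [hPos]; simp
  have m2 : a1 + a2 ∈ rs.Pos := by rw [hPos]; simp
  have m3 : (2:ℝ) • a1 + a2 ∈ rs.Pos := by rw [hPos]; simp
  have m4 : (3:ℝ) • a1 + a2 ∈ rs.Pos := by rw [hPos]; simp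
  have m5 : (3:ℝ) • a1 + (2:ℝ) • a2 ∈ rs.Pos := by rw [hPos]; simp
  have hcases : ∀ p : EucV 2 → Prop, p a1 → p a2 → p (a1 + a2) → p ((2:ℝ) • a1 + a2) →
      p ((3:ℝ) • a1 + a2) → p ((3:ℝ) • a1 + (2:ℝ) • a2) → ∀ γ ∈ rs.Pos, p γ := by
    intro p h0 h1 h2 h3 h4 h5 γ hγ
    rw [hPos] at hγ
    rcases hγ with rfl | rfl | rfl | rfl | rfl | rfl <;> assumption
  have hcoef : ∀ k l k' l' : ℝ, k • a1 + l • a2 = k' • a1 + l' • a2 → k = k' ∧ l = l' := by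
    intro k l k' l' h
    have := hind (k - k') (l - l') (by rw [← sub_eq_zero.mpr h]; module)
    exact ⟨by linarith [this.1], by linarith [this.2]⟩
  have hneg : ∀ β₁ ∈ rs.Pos, ∀ β₂ ∈ rs.Pos, ⟪β₁, β₂⟫_ℝ < 0 →
      (β₁ = a1 ∧ β₂ = a2) ∨ (β₁ = a2 ∧ β₂ = a1) ∨ (β₁ = a1 ∧ β₂ = a1 + a2) ∨
      (β₁ = a1 + a2 ∧ β₂ = a1) ∨ (β₁ = a2 ∧ β₂ = (3:ℝ) • a1 + a2) ∨
      (β₁ = (3:ℝ) • a1 + a2 ∧ β₂ = a2) := by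
    intro β₁ h₁ β₂ h₂
    revert β₂ β₁
    apply hcases <;> apply hcases <;> intro h <;>
    first
      | simp; done
      | (exfalso
         try simp only [inner_add_left, inner_add_right, real_inner_smul_left, real_inner_smul_right,
           hG12, hG21, hG22] at h
         linarith)
  constructor
  · intro h
    have i1 : ⟪a1, a2⟫_ℝ < 0 := by rw [hG12]; linarith
    have i2 : ⟪a1, a1 + a2⟫_ℝ < 0 := by rw [inner_add_right, hG12]; linarith
    have i3 : ⟪a2, (3:ℝ) • a1 + a2⟫_ℝ < 0 := by
      rw [inner_add_right, real_inner_smul_right, hG21, hG22]; linarith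
    refine ⟨?_, ?_, ?_⟩
    · rintro (hh | hh | hh | hh)
      · exact h _ hh a1 m0 a2 m1 1 1 (by norm_num) (by norm_num) (by push_cast; module) i1
      · exact h _ hh a1 m0 a2 m1 2 1 (by norm_num) (by norm_num) (by push_cast; module) i1
      · exact h _ hh a1 m0 a2 m1 3 1 (by norm_num) (by norm_num) (by push_cast; module) i1
      · exact h _ hh a1 m0 a2 m1 3 2 (by norm_num) (by norm_num) (by push_cast; module) i1
    · rintro (hh | hh | hh)
      · exact h _ hh a1 m0 _ m2 1 1 (by norm_num) (by norm_num) (by push_cast; module) i2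
      · exact h _ hh a1 m0 _ m2 2 1 (by norm_num) (by norm_num) (by push_cast; module) i2
      · exact h _ hh a1 m0 _ m2 1 2 (by norm_num) (by norm_num) (by push_cast; module) i2
    · intro hh
      exact h _ hh a2 m1 _ m4 1 1 (by norm_num) (by norm_num) (by push_cast; module) i3
  · rintro ⟨c1, c2, c3⟩
    have x2 : ∀ d₁ d₂ : ℤ, 0 < d₁ → 0 < d₂ → a2 = (d₁:ℝ) • a1 + (d₂:ℝ) • (a1 + a2) → False := by
      intro d₁ d₂ h1 h2 h
      have := (hcoef 0 1 (d₁ + d₂) d₂ (by simp only [zero_smul, zero_add, one_smul]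
                                          refine h.trans ?_; module)).1
      have h3 : 0 = d₁ + d₂ := by exact_mod_cast this
      omega
    have x3 : ∀ c : ℤ, (c = 1 ∨ c = 2) → ∀ l : ℝ, ∀ d₁ d₂ : ℤ,
        (c:ℝ) • a1 + l • a2 = (d₁:ℝ) • a2 + (d₂:ℝ) • ((3:ℝ) • a1 + a2) → False := by
      intro c hc l d₁ d₂ h
      have := (hcoef c l (3 * d₂) (d₁ + d₂) (by refine h.trans ?_; module)).1
      have h3 : c = 3 * d₂ := by exact_mod_cast this
      omega
    have main : ∀ α ∈ rs.Pos, α ∈ S → ∀ d₁ d₂ : ℤ, 0 < d₁ → 0 < d₂ → 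
        (a1 ∈ S ∨ a2 ∈ S) ∧
        (α = (d₁:ℝ) • a1 + (d₂:ℝ) • (a1 + a2) → a1 ∈ S ∨ a1 + a2 ∈ S) ∧
        (α = (d₁:ℝ) • a2 + (d₂:ℝ) • ((3:ℝ) • a1 + a2) → a2 ∈ S ∨ (3:ℝ) • a1 + a2 ∈ S) := by
      apply hcases
      · refine fun hs d₁ d₂ h1 h2 => ⟨by tauto, by tauto, fun h => ?_⟩
        exact (x3 1 (by norm_num) 0 d₁ d₂ (by rw [← h]; push_cast; module)).elim
      · exact fun hs d₁ d₂ h1 h2 => ⟨by tauto, fun h => (x2 d₁ d₂ h1 h2 h).elim, by tauto⟩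
      · refine fun hs d₁ d₂ h1 h2 => ⟨by tauto, by tauto, fun h => ?_⟩
        exact (x3 1 (by norm_num) 1 d₁ d₂ (by rw [← h]; push_cast; module)).elim
      · refine fun hs d₁ d₂ h1 h2 => ⟨by tauto, by tauto, fun h => ?_⟩
        exact (x3 2 (by norm_num) 1 d₁ d₂ (by rw [← h]; push_cast; module)).elim
      · exact fun hs d₁ d₂ h1 h2 => ⟨by tauto, by tauto, by tauto⟩
      · exact fun hs d₁ d₂ h1 h2 => ⟨by tauto, by tauto, by tauto⟩
    intro α hα β₁ hβ₁ β₂ hβ₂ d₁ d₂ hd₁ hd₂ heq hlt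
    have M := main α (hS hα) hα d₁ d₂ hd₁ hd₂
    have M' := main α (hS hα) hα d₂ d₁ hd₂ hd₁
    rcases hneg β₁ hβ₁ β₂ hβ₂ hlt with ⟨rfl, rfl⟩ | ⟨rfl, rfl⟩ | ⟨rfl, rfl⟩ | ⟨rfl, rfl⟩ |
      ⟨rfl, rfl⟩ | ⟨rfl, rfl⟩
    · exact M.1
    · exact M.1.symm
    · exact M.2.1 heq
    · exact (M'.2.1 (heq.trans (add_comm _ _))).symm
    · exact M.2.2 heq
    · exact (M'.2.2 (heq.trans (add_comm _ _))).symm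


set_option maxHeartbeats 1000000 in
lemma g2_wc
    (rs : RootSystemData 2) (a1 a2 : EucV 2)
    (hΔ : rs.Δ = {a1, a2}) (hlen : ⟪a1, a1⟫_ℝ < ⟪a2, a2⟫_ℝ)
    (hPos : rs.Pos = {a1, a2, a1 + a2, (2:ℝ) • a1 + a2, (3:ℝ) • a1 + a2,
      (3:ℝ) • a1 + (2:ℝ) • a2})
    (S : Set (EucV 2)) (hS : S ⊆ rs.Pos) :
    WCompat Set.univ rs.Pos rs.Δ S ↔
      ((a1 + a2 ∈ S ∨ (2:ℝ) • a1 + a2 ∈ S ∨ (3:ℝ) • a1 + a2 ∈ S ∨ (3:ℝ) • a1 + (2:ℝ) • a2 ∈ S →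
          a1 ∈ S ∨ a2 ∈ S) ∧
       ((3:ℝ) • a1 + (2:ℝ) • a2 ∈ S → a2 ∈ S ∨ (3:ℝ) • a1 + a2 ∈ S)) := by
  obtain ⟨hApos, hind, hG12, hG21, hG22, hinj, hsur⟩ := g2_setup rs a1 a2 hΔ hlen hPos
  have e0 : ∀ x, ⟪a1, x⟫_ℝ = 1 * ⟪a1, x⟫_ℝ + 0 * ⟪a2, x⟫_ℝ := fun x => by ring
  have e1 : ∀ x, ⟪a2, x⟫_ℝ = 0 * ⟪a1, x⟫_ℝ + 1 * ⟪a2, x⟫_ℝ := fun x => by ring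
  have e2 : ∀ x, ⟪a1 + a2, x⟫_ℝ = 1 * ⟪a1, x⟫_ℝ + 1 * ⟪a2, x⟫_ℝ := fun x => by
    rw [inner_add_left]; ring
  have e3 : ∀ x, ⟪(2:ℝ) • a1 + a2, x⟫_ℝ = 2 * ⟪a1, x⟫_ℝ + 1 * ⟪a2, x⟫_ℝ := fun x => by
    rw [inner_add_left, real_inner_smul_left]; ring
  have e4 : ∀ x, ⟪(3:ℝ) • a1 + a2, x⟫_ℝ = 3 * ⟪a1, x⟫_ℝ + 1 * ⟪a2, x⟫_ℝ := fun x => by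
    rw [inner_add_left, real_inner_smul_left]; ring
  have e5 : ∀ x, ⟪(3:ℝ) • a1 + (2:ℝ) • a2, x⟫_ℝ = 3 * ⟪a1, x⟫_ℝ + 2 * ⟪a2, x⟫_ℝ := fun x => by
    rw [inner_add_left, real_inner_smul_left, real_inner_smul_left]
  have m0 : a1 ∈ rs.Pos := by rw [hPos]; simp
  have m1 : a2 ∈ rs.Pos := by rw [hPos]; simp
  have m2 : a1 + a2 ∈ rs.Pos := by rw [hPos]; simp
  have m3 : (2:ℝ) • a1 + a2 ∈ rs.Pos := by rw [hPos]; simp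
  have m4 : (3:ℝ) • a1 + a2 ∈ rs.Pos := by rw [hPos]; simp
  have m5 : (3:ℝ) • a1 + (2:ℝ) • a2 ∈ rs.Pos := by rw [hPos]; simp
  have hcases : ∀ p : EucV 2 → Prop, p a1 → p a2 → p (a1 + a2) → p ((2:ℝ) • a1 + a2) →
      p ((3:ℝ) • a1 + a2) → p ((3:ℝ) • a1 + (2:ℝ) • a2) → ∀ γ ∈ rs.Pos, p γ := by
    intro p h0 h1 h2 h3 h4 h5 γ hγ
    rw [hPos] at hγ
    rcases hγ with rfl | rfl | rfl | rfl | rfl | rfl <;> assumption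
  have hclos : ∀ A r, IsAlcove Set.univ rs.Pos A → IsAddress rs.Pos A r → ∀ x,
      x ∈ closure A ↔ Cl6 (r a1) (r a2) (r (a1 + a2)) (r ((2:ℝ) • a1 + a2)) (r ((3:ℝ) • a1 + a2)) (r ((3:ℝ) • a1 + (2:ℝ) • a2))
        ⟪a1, x⟫_ℝ ⟪a2, x⟫_ℝ := by
    intro A r hA hr x
    rw [closure_alcove hA hr]
    constructor
    · intro h
      have h2 := h _ m2
      have h3 := h _ m3
      have h4 := h _ m4
      have h5 := h _ m5
      rw [e2] at h2
      rw [e3] at h3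
      rw [e4] at h4
      rw [e5] at h5
      simp only [one_mul] at h2 h3 h4
      exact ⟨h _ m0, h _ m1, h2, h3, h4, h5⟩
    · rintro ⟨h0, h1, h2, h3, h4, h5⟩
      refine hcases _ h0 h1 ?_ ?_ ?_ ?_
      · rw [e2]; simpa only [one_mul] using h2
      · rw [e3]; simpa only [one_mul] using h3
      · rw [e4]; simpa only [one_mul] using h4
      · rw [e5]; exact h5
  have hupper : ∀ A r, IsAlcove Set.univ rs.Pos A → IsAddress rs.Pos A r → ∀ x,
      x ∈ upperClos rs.Pos A r ↔ Up6 (r a1) (r a2) (r (a1 + a2)) (r ((2:ℝ) • a1 + a2)) (r ((3:ℝ) • a1 + a2)) (r ((3:ℝ) • a1 + (2:ℝ) • a2))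
        ⟪a1, x⟫_ℝ ⟪a2, x⟫_ℝ := by
    intro A r hA hr x
    unfold upperClos
    rw [Set.mem_ofPred_eq, hclos A r hA hr]
    constructor
    · rintro ⟨⟨c0, c1, c2, c3, c4, c5⟩, h⟩
      have h2 := h _ m2
      have h3 := h _ m3
      have h4 := h _ m4
      have h5 := h _ m5
      rw [e2] at h2
      rw [e3] at h3
      rw [e4] at h4
      rw [e5] at h5
      simp only [one_mul] at h2 h3 h4
      exact ⟨⟨h _ m0, c0.2⟩, ⟨h _ m1, c1.2⟩, ⟨h2, c2.2⟩, ⟨h3, c3.2⟩, ⟨h4, c4.2⟩, ⟨h5, c5.2⟩⟩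
    · rintro ⟨h0, h1, h2, h3, h4, h5⟩
      refine ⟨⟨⟨h0.1.le, h0.2⟩, ⟨h1.1.le, h1.2⟩, ⟨h2.1.le, h2.2⟩, ⟨h3.1.le, h3.2⟩,
        ⟨h4.1.le, h4.2⟩, ⟨h5.1.le, h5.2⟩⟩, hcases _ h0.1 h1.1 ?_ ?_ ?_ ?_⟩
      · rw [e2]; simpa only [one_mul] using h2.1
      · rw [e3]; simpa only [one_mul] using h3.1
      · rw [e4]; simpa only [one_mul] using h4.1
      · rw [e5]; exact h5.1
  constructor
  · intro h
    -- alcoves from points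
    have hpt : ∀ (u v : ℝ) (R2 R3 R4 R5 : ℤ), (0 < u ∧ u < 1) → (0 < v ∧ v < 1) →
        ((R2:ℝ) - 1 < u + v ∧ u + v < R2) → ((R3:ℝ) - 1 < 2 * u + v ∧ 2 * u + v < R3) →
        ((R4:ℝ) - 1 < 3 * u + v ∧ 3 * u + v < R4) →
        ((R5:ℝ) - 1 < 3 * u + 2 * v ∧ 3 * u + 2 * v < R5) →
        ∃ A r, IsAlcove Set.univ rs.Pos A ∧ A ⊆ fundPar Set.univ rs.Δ ∧ IsAddress rs.Pos A r ∧
          r a1 = 1 ∧ r a2 = 1 ∧ r (a1 + a2) = R2 ∧ r ((2:ℝ) • a1 + a2) = R3 ∧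
          r ((3:ℝ) • a1 + a2) = R4 ∧ r ((3:ℝ) • a1 + (2:ℝ) • a2) = R5 := by
      intro u v R2 R3 R4 R5 hu hv h2 h3 h4 h5
      obtain ⟨c, rfl, rfl⟩ := hsur u v
      have hno : ∀ (R : ℤ) (t : ℝ), ((R:ℝ) - 1 < t ∧ t < R) → ∀ n : ℤ, t ≠ n := by
        rintro R t ⟨q1, q2⟩ n rfl
        have q1' : R - 1 < n := by exact_mod_cast q1
        have q2' : n < R := by exact_mod_cast q2
        omega
      have g0 : ((1:ℤ):ℝ) - 1 < ⟪a1, c⟫_ℝ ∧ ⟪a1, c⟫_ℝ < (1:ℤ) := by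
        push_cast; constructor <;> linarith [hu.1, hu.2]
      have g1 : ((1:ℤ):ℝ) - 1 < ⟪a2, c⟫_ℝ ∧ ⟪a2, c⟫_ℝ < (1:ℤ) := by
        push_cast; constructor <;> linarith [hv.1, hv.2]
      have g2 : ((R2:ℤ):ℝ) - 1 < ⟪a1 + a2, c⟫_ℝ ∧ ⟪a1 + a2, c⟫_ℝ < R2 := by
        rw [e2]; simpa only [one_mul] using h2
      have g3 : ((R3:ℤ):ℝ) - 1 < ⟪(2:ℝ) • a1 + a2, c⟫_ℝ ∧ ⟪(2:ℝ) • a1 + a2, c⟫_ℝ < R3 := by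
        rw [e3]; simpa only [one_mul] using h3
      have g4 : ((R4:ℤ):ℝ) - 1 < ⟪(3:ℝ) • a1 + a2, c⟫_ℝ ∧ ⟪(3:ℝ) • a1 + a2, c⟫_ℝ < R4 := by
        rw [e4]; simpa only [one_mul] using h4
      have g5 : ((R5:ℤ):ℝ) - 1 < ⟪(3:ℝ) • a1 + (2:ℝ) • a2, c⟫_ℝ ∧
          ⟪(3:ℝ) • a1 + (2:ℝ) • a2, c⟫_ℝ < R5 := by
        rw [e5]; exact h5
      obtain ⟨A, hA, hcA, hr⟩ := alcove_exists (P := rs.Pos) c (hcases _ (hno _ _ g0) (hno _ _ g1)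
        (hno _ _ g2) (hno _ _ g3) (hno _ _ g4) (hno _ _ g5))
      have k0 := Int.ceil_eq_iff.mpr ⟨g0.1, g0.2.le⟩
      have k1 := Int.ceil_eq_iff.mpr ⟨g1.1, g1.2.le⟩
      refine ⟨A, _, hA, ?_, hr, k0, k1, Int.ceil_eq_iff.mpr ⟨g2.1, g2.2.le⟩,
        Int.ceil_eq_iff.mpr ⟨g3.1, g3.2.le⟩, Int.ceil_eq_iff.mpr ⟨g4.1, g4.2.le⟩,
        Int.ceil_eq_iff.mpr ⟨g5.1, g5.2.le⟩⟩
      intro x hx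
      refine ⟨trivial, ?_⟩
      rw [hΔ]
      have q0 := hr a1 m0 x hx
      have q1 := hr a2 m1 x hx
      simp only [k0] at q0
      simp only [k1] at q1
      push_cast at q0 q1
      intro a ha
      rcases ha with rfl | rfl
      · constructor <;> linarith [q0.1, q0.2]
      · constructor <;> linarith [q1.1, q1.2]
    have hnw : ∀ (A : Set (EucV 2)) (β : EucV 2) (m : ℤ) (b1 b2 : ℝ) (p : EucV 2),
        (∀ x, ⟪β, x⟫_ℝ = b1 * ⟪a1, x⟫_ℝ + b2 * ⟪a2, x⟫_ℝ) → b2 ≠ 0 → ⟪β, p⟫_ℝ = m →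
        (∀ x ∈ closure A, b1 * ⟪a1, x⟫_ℝ + b2 * ⟪a2, x⟫_ℝ = m →
          ⟪a1, x⟫_ℝ = ⟪a1, p⟫_ℝ ∧ ⟪a2, x⟫_ℝ = ⟪a2, p⟫_ℝ) → ¬ IsWall Set.univ β m A := by
      intro A β m b1 b2 p hβ hb hp hx
      obtain ⟨w, w1, w2⟩ := hsur b2 (-b1)
      refine not_wall p w ?_ ?_ hp ?_
      · rintro rfl
        rw [inner_zero_right] at w1
        exact hb w1.symm
      · rw [hβ, w1, w2]; ring
      · intro x hxA hxm
        rw [hβ] at hxm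
        exact hinj _ _ (hx x hxA hxm).1 (hx x hxA hxm).2
    have hget : ∀ A r, IsAlcove Set.univ rs.Pos A → A ⊆ fundPar Set.univ rs.Δ →
        IsAddress rs.Pos A r → ∀ p ∈ upperClos rs.Pos A r, ∀ α ∈ S, ∀ n : ℤ, ⟪α, p⟫_ℝ = n →
        ∃ β ∈ S, IsWall Set.univ β (r β) A ∧ ⟪β, p⟫_ℝ = r β := by
      intro A r hA hAf hr p hp α hα n hn
      rcases h A hA hAf r hr α hα n with h1 | ⟨β, hβ, m, rfl, -, hw, hsub⟩
      · exact (Set.eq_empty_iff_forall_notMem.mp h1 p ⟨hp, hn⟩).elim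
      · exact ⟨β, hβ, hw, hsub ⟨hp, hn⟩⟩
    constructor
    · obtain ⟨A, r, hA, hAf, hr, r0, r1, r2, r3, r4, r5⟩ := hpt (9/10) (9/10) 2 3 4 5
        (by norm_num) (by norm_num) (by norm_num) (by norm_num) (by norm_num) (by norm_num)
      have hC := hclos A r hA hr
      have hU := hupper A r hA hr
      rw [r0, r1, r2, r3, r4, r5] at hC hU
      obtain ⟨p, p1, p2⟩ := hsur 1 1
      have hp : p ∈ upperClos rs.Pos A r := by
        rw [hU, p1, p2]; unfold Up6; norm_num
      have hfin : ∀ β ∈ rs.Pos, β ∈ S → IsWall Set.univ β (r β) A → a1 ∈ S ∨ a2 ∈ S := by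
        apply hcases
        · exact fun hs _ => Or.inl hs
        · exact fun hs _ => Or.inr hs
        · intro _ hw
          refine (hnw A _ _ 1 1 p e2 (by norm_num)
            (by rw [e2, p1, p2, r2]; norm_num) ?_ hw).elim
          intro x hx hxm
          rw [r2] at hxm
          obtain ⟨c0, c1, c2, c3, c4, c5⟩ := (hC x).mp hx
          rw [p1, p2]
          push_cast at *
          constructor <;> linarith [c0.1, c0.2, c1.1, c1.2]
        · intro _ hw
          refine (hnw A _ _ 2 1 p e3 (by norm_num)
            (by rw [e3, p1, p2, r3]; norm_num) ?_ hw).elim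
          intro x hx hxm
          rw [r3] at hxm
          obtain ⟨c0, c1, c2, c3, c4, c5⟩ := (hC x).mp hx
          rw [p1, p2]
          push_cast at *
          constructor <;> linarith [c0.1, c0.2, c1.1, c1.2]
        · intro _ hw
          refine (hnw A _ _ 3 1 p e4 (by norm_num)
            (by rw [e4, p1, p2, r4]; norm_num) ?_ hw).elim
          intro x hx hxm
          rw [r4] at hxm
          obtain ⟨c0, c1, c2, c3, c4, c5⟩ := (hC x).mp hx
          rw [p1, p2]
          push_cast at *
          constructor <;> linarith [c0.1, c0.2, c1.1, c1.2]
        · intro _ hw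
          refine (hnw A _ _ 3 2 p e5 (by norm_num)
            (by rw [e5, p1, p2, r5]; norm_num) ?_ hw).elim
          intro x hx hxm
          rw [r5] at hxm
          obtain ⟨c0, c1, c2, c3, c4, c5⟩ := (hC x).mp hx
          rw [p1, p2]
          push_cast at *
          constructor <;> linarith [c0.1, c0.2, c1.1, c1.2]
      have hall : ∀ α ∈ S, ∀ n : ℤ, ⟪α, p⟫_ℝ = n → a1 ∈ S ∨ a2 ∈ S := by
        intro α hα n hn
        obtain ⟨β, hβ, hw, -⟩ := hget A r hA hAf hr p hp α hα n hn
        exact hfin β (hS hβ) hβ hw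
      rintro (hs | hs | hs | hs)
      · exact hall _ hs 2 (by rw [e2, p1, p2]; norm_num)
      · exact hall _ hs 3 (by rw [e3, p1, p2]; norm_num)
      · exact hall _ hs 4 (by rw [e4, p1, p2]; norm_num)
      · exact hall _ hs 5 (by rw [e5, p1, p2]; norm_num)
    · obtain ⟨A, r, hA, hAf, hr, r0, r1, r2, r3, r4, r5⟩ := hpt (3/10) (8/10) 2 2 2 3
        (by norm_num) (by norm_num) (by norm_num) (by norm_num) (by norm_num) (by norm_num)
      have hC := hclos A r hA hr
      have hU := hupper A r hA hr
      rw [r0, r1, r2, r3, r4, r5] at hC hU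
      obtain ⟨p, p1, p2⟩ := hsur (1/3) 1
      have hp : p ∈ upperClos rs.Pos A r := by
        rw [hU, p1, p2]; unfold Up6; norm_num
      have hfin : ∀ β ∈ rs.Pos, β ∈ S → IsWall Set.univ β (r β) A → ⟪β, p⟫_ℝ = r β →
          a2 ∈ S ∨ (3:ℝ) • a1 + a2 ∈ S := by
        apply hcases
        · intro _ _ hb; rw [p1, r0] at hb; norm_num at hb
        · exact fun hs _ _ => Or.inl hs
        · intro _ _ hb; rw [e2, p1, p2, r2] at hb; norm_num at hb
        · intro _ _ hb; rw [e3, p1, p2, r3] at hb; norm_num at hb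
        · exact fun hs _ _ => Or.inr hs
        · intro _ hw _
          refine (hnw A _ _ 3 2 p e5 (by norm_num)
            (by rw [e5, p1, p2, r5]; norm_num) ?_ hw).elim
          intro x hx hxm
          rw [r5] at hxm
          obtain ⟨c0, c1, c2, c3, c4, c5⟩ := (hC x).mp hx
          rw [p1, p2]
          push_cast at *
          constructor <;> linarith [c1.1, c1.2, c4.1, c4.2]
      intro hs
      obtain ⟨β, hβ, hw, hb⟩ := hget A r hA hAf hr p hp _ hs 3 (by rw [e5, p1, p2]; norm_num)
      exact hfin β (hS hβ) hβ hw hb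
  · rintro ⟨c1, c2⟩ A hA hAf r hr α hα n
    have hC := hclos A r hA hr
    have hU := hupper A r hA hr
    have hwall : ∀ (β : EucV 2) (b1 b2 : ℝ), (∀ x, ⟪β, x⟫_ℝ = b1 * ⟪a1, x⟫_ℝ + b2 * ⟪a2, x⟫_ℝ) →
        ∀ (p1 p2 q1 q2 : ℝ) (m : ℤ), r β = m →
        (∀ x, ⟪a1, x⟫_ℝ = p1 → ⟪a2, x⟫_ℝ = p2 → x ∈ closure A) →
        (∀ x, ⟪a1, x⟫_ℝ = q1 → ⟪a2, x⟫_ℝ = q2 → x ∈ closure A) →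
        b1 * p1 + b2 * p2 = m → b1 * q1 + b2 * q2 = m →
        ((b2 ≠ 0 ∧ q1 - p1 ≠ 0) ∨ (b1 ≠ 0 ∧ q2 - p2 ≠ 0)) → IsWall Set.univ β (r β) A := by
      intro β b1 b2 hβ p1 p2 q1 q2 m hm hp hq h1 h2 h3
      obtain ⟨p, rfl, rfl⟩ := hsur p1 p2
      obtain ⟨q, rfl, rfl⟩ := hsur q1 q2
      rw [hm]
      exact wall_of_pts hinj b1 b2 hβ p q (hp p rfl rfl) (hq q rfl rfl) (by rw [hβ, h1])
        (by rw [hβ, h2]) h3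
    suffices hX : (∀ x ∈ upperClos rs.Pos A r, ⟪α, x⟫_ℝ = r α → False) ∨
        ∃ β ∈ S, 1 ≤ r β ∧ IsWall Set.univ β (r β) A ∧
          ∀ x ∈ upperClos rs.Pos A r, ⟪α, x⟫_ℝ = r α → ⟪β, x⟫_ℝ = r β by
      have hnr : ∀ x ∈ upperClos rs.Pos A r, ⟪α, x⟫_ℝ = n → ⟪α, x⟫_ℝ = r α := by
        intro x hx hxn
        have q1 := hx.2 α (hS hα)
        have q2 := ((closure_alcove hA hr x).mp hx.1 α (hS hα)).2
        rw [hxn] at q1 q2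
        have q1' : r α - 1 < n := by exact_mod_cast q1
        have q2' : n ≤ r α := by exact_mod_cast q2
        have : n = r α := by omega
        rw [hxn, this]
      rcases hX with hX | ⟨β, hβ, h1, hw, hx⟩
      · left
        apply Set.eq_empty_of_forall_notMem
        rintro x ⟨hx, hxn⟩
        exact hX x hx (hnr x hx hxn)
      · right
        refine ⟨β, hβ, r β, rfl, h1, hw, ?_⟩
        rintro x ⟨hxu, hxn⟩
        exact hx x hxu (hnr x hxu hxn)
    have hcA : ∃ c, c ∈ A := by
      obtain ⟨c, hc, rfl⟩ := hA
      exact ⟨c, mem_connectedComponentIn hc⟩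
    obtain ⟨c, hcA⟩ := hcA
    have hf := (hAf hcA).2
    rw [hΔ] at hf
    have f1 := hf a1 (by simp)
    have f2 := hf a2 (by simp)
    have g2 := hr _ m2 c hcA
    have g3 := hr _ m3 c hcA
    have g4 := hr _ m4 c hcA
    have g5 := hr _ m5 c hcA
    rw [e2] at g2
    rw [e3] at g3
    rw [e4] at g4
    rw [e5] at g5
    simp only [one_mul] at g2 g3 g4
    obtain ⟨r0, r1, hlist⟩ := alcove_list _ _ _ _ _ _ _ _ f1.1 f1.2 f2.1 f2.2 (hr _ m0 c hcA) (hr _ m1 c hcA)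
      g2 g3 g4 g5
    rw [r0, r1] at hC hU
    clear hclos hupper hAf
    revert hα
    have hαP : α ∈ rs.Pos ∨ α ∉ S := by
      by_cases hs : α ∈ S
      · exact Or.inl (hS hs)
      · exact Or.inr hs
    rcases hαP with hαP | hαP
    swap
    · exact fun hs => (hαP hs).elim
    revert α
    rcases hlist with ⟨r2, r3, r4, r5⟩ | ⟨r2, r3, r4, r5⟩ | ⟨r2, r3, r4, r5⟩ | ⟨r2, r3, r4, r5⟩ |
      ⟨r2, r3, r4, r5⟩ | ⟨r2, r3, r4, r5⟩ | ⟨r2, r3, r4, r5⟩ | ⟨r2, r3, r4, r5⟩ |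
      ⟨r2, r3, r4, r5⟩ | ⟨r2, r3, r4, r5⟩ | ⟨r2, r3, r4, r5⟩ | ⟨r2, r3, r4, r5⟩
    · rw [r2, r3, r4, r5] at hC hU
      have w5 : IsWall Set.univ ((3:ℝ) • a1 + (2:ℝ) • a2) (r ((3:ℝ) • a1 + (2:ℝ) • a2)) A := by
        refine hwall _ 3 2 e5 (0) (1/2) (1/3) (0) _ r5 ?_ ?_
          (by norm_num) (by norm_num) (Or.inl (by norm_num)) <;>
        · intro x h1 h2
          rw [hC, h1, h2]; unfold Cl6; norm_num
      apply hcases <;> try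
        refine fun _ => Or.inl (fun x hx h => ?_)
        obtain ⟨d0, d1, d2, d3, d4, d5⟩ := (hU x).mp hx
        simp only [e2, e3, e4, e5, r0, r1, r2, r3, r4, r5] at h
        push_cast at d0 d1 d2 d3 d4 d5 h
        linarith [d0.1, d0.2, d1.1, d1.2, d2.1, d2.2, d3.1, d3.2, d4.1, d4.2, d5.1, d5.2]
      · exact fun hs => Or.inr ⟨_, hs, r5 ▸ by norm_num, w5, fun _ _ h => h⟩
    · rw [r2, r3, r4, r5] at hC hU
      have w4 : IsWall Set.univ ((3:ℝ) • a1 + a2) (r ((3:ℝ) • a1 + a2)) A := by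
        refine hwall _ 3 1 e4 (0) (1) (1/3) (0) _ r4 ?_ ?_
          (by norm_num) (by norm_num) (Or.inl (by norm_num)) <;>
        · intro x h1 h2
          rw [hC, h1, h2]; unfold Cl6; norm_num
      apply hcases <;> try
        refine fun _ => Or.inl (fun x hx h => ?_)
        obtain ⟨d0, d1, d2, d3, d4, d5⟩ := (hU x).mp hx
        simp only [e2, e3, e4, e5, r0, r1, r2, r3, r4, r5] at h
        push_cast at d0 d1 d2 d3 d4 d5 h
        linarith [d0.1, d0.2, d1.1, d1.2, d2.1, d2.2, d3.1, d3.2, d4.1, d4.2, d5.1, d5.2]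
      · exact fun hs => Or.inr ⟨_, hs, r4 ▸ by norm_num, w4, fun _ _ h => h⟩
    · rw [r2, r3, r4, r5] at hC hU
      have w3 : IsWall Set.univ ((2:ℝ) • a1 + a2) (r ((2:ℝ) • a1 + a2)) A := by
        refine hwall _ 2 1 e3 (0) (1) (1/2) (0) _ r3 ?_ ?_
          (by norm_num) (by norm_num) (Or.inl (by norm_num)) <;>
        · intro x h1 h2
          rw [hC, h1, h2]; unfold Cl6; norm_num
      apply hcases <;> try
        refine fun _ => Or.inl (fun x hx h => ?_)
        obtain ⟨d0, d1, d2, d3, d4, d5⟩ := (hU x).mp hx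
        simp only [e2, e3, e4, e5, r0, r1, r2, r3, r4, r5] at h
        push_cast at d0 d1 d2 d3 d4 d5 h
        linarith [d0.1, d0.2, d1.1, d1.2, d2.1, d2.2, d3.1, d3.2, d4.1, d4.2, d5.1, d5.2]
      · exact fun hs => Or.inr ⟨_, hs, r3 ▸ by norm_num, w3, fun _ _ h => h⟩
    · rw [r2, r3, r4, r5] at hC hU
      have w5 : IsWall Set.univ ((3:ℝ) • a1 + (2:ℝ) • a2) (r ((3:ℝ) • a1 + (2:ℝ) • a2)) A := by
        refine hwall _ 3 2 e5 (0) (1) (2/3) (0) _ r5 ?_ ?_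
          (by norm_num) (by norm_num) (Or.inl (by norm_num)) <;>
        · intro x h1 h2
          rw [hC, h1, h2]; unfold Cl6; norm_num
      apply hcases <;> try
        refine fun _ => Or.inl (fun x hx h => ?_)
        obtain ⟨d0, d1, d2, d3, d4, d5⟩ := (hU x).mp hx
        simp only [e2, e3, e4, e5, r0, r1, r2, r3, r4, r5] at h
        push_cast at d0 d1 d2 d3 d4 d5 h
        linarith [d0.1, d0.2, d1.1, d1.2, d2.1, d2.2, d3.1, d3.2, d4.1, d4.2, d5.1, d5.2]
      · exact fun hs => Or.inr ⟨_, hs, r5 ▸ by norm_num, w5, fun _ _ h => h⟩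
    · rw [r2, r3, r4, r5] at hC hU
      have w2 : IsWall Set.univ (a1 + a2) (r (a1 + a2)) A := by
        refine hwall _ 1 1 e2 (0) (1) (1/2) (1/2) _ r2 ?_ ?_
          (by norm_num) (by norm_num) (Or.inl (by norm_num)) <;>
        · intro x h1 h2
          rw [hC, h1, h2]; unfold Cl6; norm_num
      have w4 : IsWall Set.univ ((3:ℝ) • a1 + a2) (r ((3:ℝ) • a1 + a2)) A := by
        refine hwall _ 3 1 e4 (1/2) (1/2) (2/3) (0) _ r4 ?_ ?_
          (by norm_num) (by norm_num) (Or.inl (by norm_num)) <;>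
        · intro x h1 h2
          rw [hC, h1, h2]; unfold Cl6; norm_num
      apply hcases <;> try
        refine fun _ => Or.inl (fun x hx h => ?_)
        obtain ⟨d0, d1, d2, d3, d4, d5⟩ := (hU x).mp hx
        simp only [e2, e3, e4, e5, r0, r1, r2, r3, r4, r5] at h
        push_cast at d0 d1 d2 d3 d4 d5 h
        linarith [d0.1, d0.2, d1.1, d1.2, d2.1, d2.2, d3.1, d3.2, d4.1, d4.2, d5.1, d5.2]
      · exact fun hs => Or.inr ⟨_, hs, r2 ▸ by norm_num, w2, fun _ _ h => h⟩
      · exact fun hs => Or.inr ⟨_, hs, r4 ▸ by norm_num, w4, fun _ _ h => h⟩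
    · rw [r2, r3, r4, r5] at hC hU
      have w2 : IsWall Set.univ (a1 + a2) (r (a1 + a2)) A := by
        refine hwall _ 1 1 e2 (1/2) (1/2) (1) (0) _ r2 ?_ ?_
          (by norm_num) (by norm_num) (Or.inl (by norm_num)) <;>
        · intro x h1 h2
          rw [hC, h1, h2]; unfold Cl6; norm_num
      apply hcases <;> try
        refine fun _ => Or.inl (fun x hx h => ?_)
        obtain ⟨d0, d1, d2, d3, d4, d5⟩ := (hU x).mp hx
        simp only [e2, e3, e4, e5, r0, r1, r2, r3, r4, r5] at h
        push_cast at d0 d1 d2 d3 d4 d5 h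
        linarith [d0.1, d0.2, d1.1, d1.2, d2.1, d2.2, d3.1, d3.2, d4.1, d4.2, d5.1, d5.2]
      · exact fun hs => Or.inr ⟨_, hs, r2 ▸ by norm_num, w2, fun _ _ h => h⟩
    · rw [r2, r3, r4, r5] at hC hU
      have w1 : IsWall Set.univ a2 (r a2) A := by
        refine hwall _ 0 1 e1 (0) (1) (1/3) (1) _ r1 ?_ ?_
          (by norm_num) (by norm_num) (Or.inl (by norm_num)) <;>
        · intro x h1 h2
          rw [hC, h1, h2]; unfold Cl6; norm_num
      have w4 : IsWall Set.univ ((3:ℝ) • a1 + a2) (r ((3:ℝ) • a1 + a2)) A := by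
        refine hwall _ 3 1 e4 (1/3) (1) (1/2) (1/2) _ r4 ?_ ?_
          (by norm_num) (by norm_num) (Or.inl (by norm_num)) <;>
        · intro x h1 h2
          rw [hC, h1, h2]; unfold Cl6; norm_num
      apply hcases <;> try
        refine fun _ => Or.inl (fun x hx h => ?_)
        obtain ⟨d0, d1, d2, d3, d4, d5⟩ := (hU x).mp hx
        simp only [e2, e3, e4, e5, r0, r1, r2, r3, r4, r5] at h
        push_cast at d0 d1 d2 d3 d4 d5 h
        linarith [d0.1, d0.2, d1.1, d1.2, d2.1, d2.2, d3.1, d3.2, d4.1, d4.2, d5.1, d5.2]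
      · exact fun hs => Or.inr ⟨_, hs, r1 ▸ by norm_num, w1, fun _ _ h => h⟩
      · exact fun hs => Or.inr ⟨_, hs, r4 ▸ by norm_num, w4, fun _ _ h => h⟩
      · intro hs
        right
        rcases c2 hs with hb | hb
        · refine ⟨_, hb, r1 ▸ by norm_num, w1, fun x hx h => ?_⟩
          obtain ⟨d0, d1, d2, d3, d4, d5⟩ := (hU x).mp hx
          rw [e5, r5] at h
          rw [r1]
          push_cast at *
          linarith [d0.1, d0.2, d1.1, d1.2, d2.1, d2.2, d3.1, d3.2, d4.1, d4.2, d5.1, d5.2]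
        · refine ⟨_, hb, r4 ▸ by norm_num, w4, fun x hx h => ?_⟩
          obtain ⟨d0, d1, d2, d3, d4, d5⟩ := (hU x).mp hx
          rw [e5, r5] at h
          rw [e4, r4]
          push_cast at *
          linarith [d0.1, d0.2, d1.1, d1.2, d2.1, d2.2, d3.1, d3.2, d4.1, d4.2, d5.1, d5.2]
    · rw [r2, r3, r4, r5] at hC hU
      have w5 : IsWall Set.univ ((3:ℝ) • a1 + (2:ℝ) • a2) (r ((3:ℝ) • a1 + (2:ℝ) • a2)) A := by
        refine hwall _ 3 2 e5 (1/3) (1) (1) (0) _ r5 ?_ ?_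
          (by norm_num) (by norm_num) (Or.inl (by norm_num)) <;>
        · intro x h1 h2
          rw [hC, h1, h2]; unfold Cl6; norm_num
      apply hcases <;> try
        refine fun _ => Or.inl (fun x hx h => ?_)
        obtain ⟨d0, d1, d2, d3, d4, d5⟩ := (hU x).mp hx
        simp only [e2, e3, e4, e5, r0, r1, r2, r3, r4, r5] at h
        push_cast at d0 d1 d2 d3 d4 d5 h
        linarith [d0.1, d0.2, d1.1, d1.2, d2.1, d2.2, d3.1, d3.2, d4.1, d4.2, d5.1, d5.2]
      · exact fun hs => Or.inr ⟨_, hs, r5 ▸ by norm_num, w5, fun _ _ h => h⟩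
    · rw [r2, r3, r4, r5] at hC hU
      have w1 : IsWall Set.univ a2 (r a2) A := by
        refine hwall _ 0 1 e1 (1/3) (1) (1/2) (1) _ r1 ?_ ?_
          (by norm_num) (by norm_num) (Or.inl (by norm_num)) <;>
        · intro x h1 h2
          rw [hC, h1, h2]; unfold Cl6; norm_num
      have w3 : IsWall Set.univ ((2:ℝ) • a1 + a2) (r ((2:ℝ) • a1 + a2)) A := by
        refine hwall _ 2 1 e3 (1/2) (1) (1) (0) _ r3 ?_ ?_
          (by norm_num) (by norm_num) (Or.inl (by norm_num)) <;>
        · intro x h1 h2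
          rw [hC, h1, h2]; unfold Cl6; norm_num
      apply hcases <;> try
        refine fun _ => Or.inl (fun x hx h => ?_)
        obtain ⟨d0, d1, d2, d3, d4, d5⟩ := (hU x).mp hx
        simp only [e2, e3, e4, e5, r0, r1, r2, r3, r4, r5] at h
        push_cast at d0 d1 d2 d3 d4 d5 h
        linarith [d0.1, d0.2, d1.1, d1.2, d2.1, d2.2, d3.1, d3.2, d4.1, d4.2, d5.1, d5.2]
      · exact fun hs => Or.inr ⟨_, hs, r1 ▸ by norm_num, w1, fun _ _ h => h⟩
      · exact fun hs => Or.inr ⟨_, hs, r3 ▸ by norm_num, w3, fun _ _ h => h⟩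
    · rw [r2, r3, r4, r5] at hC hU
      have w1 : IsWall Set.univ a2 (r a2) A := by
        refine hwall _ 0 1 e1 (1/2) (1) (2/3) (1) _ r1 ?_ ?_
          (by norm_num) (by norm_num) (Or.inl (by norm_num)) <;>
        · intro x h1 h2
          rw [hC, h1, h2]; unfold Cl6; norm_num
      have w4 : IsWall Set.univ ((3:ℝ) • a1 + a2) (r ((3:ℝ) • a1 + a2)) A := by
        refine hwall _ 3 1 e4 (2/3) (1) (1) (0) _ r4 ?_ ?_
          (by norm_num) (by norm_num) (Or.inl (by norm_num)) <;>
        · intro x h1 h2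
          rw [hC, h1, h2]; unfold Cl6; norm_num
      apply hcases <;> try
        refine fun _ => Or.inl (fun x hx h => ?_)
        obtain ⟨d0, d1, d2, d3, d4, d5⟩ := (hU x).mp hx
        simp only [e2, e3, e4, e5, r0, r1, r2, r3, r4, r5] at h
        push_cast at d0 d1 d2 d3 d4 d5 h
        linarith [d0.1, d0.2, d1.1, d1.2, d2.1, d2.2, d3.1, d3.2, d4.1, d4.2, d5.1, d5.2]
      · exact fun hs => Or.inr ⟨_, hs, r1 ▸ by norm_num, w1, fun _ _ h => h⟩
      · exact fun hs => Or.inr ⟨_, hs, r4 ▸ by norm_num, w4, fun _ _ h => h⟩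
      · intro hs
        right
        rcases c2 hs with hb | hb
        · refine ⟨_, hb, r1 ▸ by norm_num, w1, fun x hx h => ?_⟩
          obtain ⟨d0, d1, d2, d3, d4, d5⟩ := (hU x).mp hx
          rw [e5, r5] at h
          rw [r1]
          push_cast at *
          linarith [d0.1, d0.2, d1.1, d1.2, d2.1, d2.2, d3.1, d3.2, d4.1, d4.2, d5.1, d5.2]
        · refine ⟨_, hb, r4 ▸ by norm_num, w4, fun x hx h => ?_⟩
          obtain ⟨d0, d1, d2, d3, d4, d5⟩ := (hU x).mp hx
          rw [e5, r5] at h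
          rw [e4, r4]
          push_cast at *
          linarith [d0.1, d0.2, d1.1, d1.2, d2.1, d2.2, d3.1, d3.2, d4.1, d4.2, d5.1, d5.2]
    · rw [r2, r3, r4, r5] at hC hU
      have w0 : IsWall Set.univ a1 (r a1) A := by
        refine hwall _ 1 0 e0 (1) (0) (1) (1/2) _ r0 ?_ ?_
          (by norm_num) (by norm_num) (Or.inr (by norm_num)) <;>
        · intro x h1 h2
          rw [hC, h1, h2]; unfold Cl6; norm_num
      have w5 : IsWall Set.univ ((3:ℝ) • a1 + (2:ℝ) • a2) (r ((3:ℝ) • a1 + (2:ℝ) • a2)) A := by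
        refine hwall _ 3 2 e5 (2/3) (1) (1) (1/2) _ r5 ?_ ?_
          (by norm_num) (by norm_num) (Or.inl (by norm_num)) <;>
        · intro x h1 h2
          rw [hC, h1, h2]; unfold Cl6; norm_num
      apply hcases <;> try
        refine fun _ => Or.inl (fun x hx h => ?_)
        obtain ⟨d0, d1, d2, d3, d4, d5⟩ := (hU x).mp hx
        simp only [e2, e3, e4, e5, r0, r1, r2, r3, r4, r5] at h
        push_cast at d0 d1 d2 d3 d4 d5 h
        linarith [d0.1, d0.2, d1.1, d1.2, d2.1, d2.2, d3.1, d3.2, d4.1, d4.2, d5.1, d5.2]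
      · exact fun hs => Or.inr ⟨_, hs, r0 ▸ by norm_num, w0, fun _ _ h => h⟩
      · exact fun hs => Or.inr ⟨_, hs, r5 ▸ by norm_num, w5, fun _ _ h => h⟩
    · rw [r2, r3, r4, r5] at hC hU
      have w0 : IsWall Set.univ a1 (r a1) A := by
        refine hwall _ 1 0 e0 (1) (1/2) (1) (1) _ r0 ?_ ?_
          (by norm_num) (by norm_num) (Or.inr (by norm_num)) <;>
        · intro x h1 h2
          rw [hC, h1, h2]; unfold Cl6; norm_num
      have w1 : IsWall Set.univ a2 (r a2) A := by
        refine hwall _ 0 1 e1 (2/3) (1) (1) (1) _ r1 ?_ ?_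
          (by norm_num) (by norm_num) (Or.inl (by norm_num)) <;>
        · intro x h1 h2
          rw [hC, h1, h2]; unfold Cl6; norm_num
      apply hcases <;> try
        refine fun _ => Or.inl (fun x hx h => ?_)
        obtain ⟨d0, d1, d2, d3, d4, d5⟩ := (hU x).mp hx
        simp only [e2, e3, e4, e5, r0, r1, r2, r3, r4, r5] at h
        push_cast at d0 d1 d2 d3 d4 d5 h
        linarith [d0.1, d0.2, d1.1, d1.2, d2.1, d2.2, d3.1, d3.2, d4.1, d4.2, d5.1, d5.2]
      · exact fun hs => Or.inr ⟨_, hs, r0 ▸ by norm_num, w0, fun _ _ h => h⟩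
      · exact fun hs => Or.inr ⟨_, hs, r1 ▸ by norm_num, w1, fun _ _ h => h⟩
      · intro hs
        right
        rcases c1 (by tauto) with hb | hb
        · refine ⟨_, hb, r0 ▸ by norm_num, w0, fun x hx h => ?_⟩
          obtain ⟨d0, d1, d2, d3, d4, d5⟩ := (hU x).mp hx
          rw [e2, r2] at h
          rw [r0]
          push_cast at *
          linarith [d0.1, d0.2, d1.1, d1.2, d2.1, d2.2, d3.1, d3.2, d4.1, d4.2, d5.1, d5.2]
        · refine ⟨_, hb, r1 ▸ by norm_num, w1, fun x hx h => ?_⟩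
          obtain ⟨d0, d1, d2, d3, d4, d5⟩ := (hU x).mp hx
          rw [e2, r2] at h
          rw [r1]
          push_cast at *
          linarith [d0.1, d0.2, d1.1, d1.2, d2.1, d2.2, d3.1, d3.2, d4.1, d4.2, d5.1, d5.2]
      · intro hs
        right
        rcases c1 (by tauto) with hb | hb
        · refine ⟨_, hb, r0 ▸ by norm_num, w0, fun x hx h => ?_⟩
          obtain ⟨d0, d1, d2, d3, d4, d5⟩ := (hU x).mp hx
          rw [e3, r3] at h
          rw [r0]
          push_cast at *
          linarith [d0.1, d0.2, d1.1, d1.2, d2.1, d2.2, d3.1, d3.2, d4.1, d4.2, d5.1, d5.2]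
        · refine ⟨_, hb, r1 ▸ by norm_num, w1, fun x hx h => ?_⟩
          obtain ⟨d0, d1, d2, d3, d4, d5⟩ := (hU x).mp hx
          rw [e3, r3] at h
          rw [r1]
          push_cast at *
          linarith [d0.1, d0.2, d1.1, d1.2, d2.1, d2.2, d3.1, d3.2, d4.1, d4.2, d5.1, d5.2]
      · intro hs
        right
        rcases c1 (by tauto) with hb | hb
        · refine ⟨_, hb, r0 ▸ by norm_num, w0, fun x hx h => ?_⟩
          obtain ⟨d0, d1, d2, d3, d4, d5⟩ := (hU x).mp hx
          rw [e4, r4] at h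
          rw [r0]
          push_cast at *
          linarith [d0.1, d0.2, d1.1, d1.2, d2.1, d2.2, d3.1, d3.2, d4.1, d4.2, d5.1, d5.2]
        · refine ⟨_, hb, r1 ▸ by norm_num, w1, fun x hx h => ?_⟩
          obtain ⟨d0, d1, d2, d3, d4, d5⟩ := (hU x).mp hx
          rw [e4, r4] at h
          rw [r1]
          push_cast at *
          linarith [d0.1, d0.2, d1.1, d1.2, d2.1, d2.2, d3.1, d3.2, d4.1, d4.2, d5.1, d5.2]
      · intro hs
        right
        rcases c1 (by tauto) with hb | hb
        · refine ⟨_, hb, r0 ▸ by norm_num, w0, fun x hx h => ?_⟩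
          obtain ⟨d0, d1, d2, d3, d4, d5⟩ := (hU x).mp hx
          rw [e5, r5] at h
          rw [r0]
          push_cast at *
          linarith [d0.1, d0.2, d1.1, d1.2, d2.1, d2.2, d3.1, d3.2, d4.1, d4.2, d5.1, d5.2]
        · refine ⟨_, hb, r1 ▸ by norm_num, w1, fun x hx h => ?_⟩
          obtain ⟨d0, d1, d2, d3, d4, d5⟩ := (hU x).mp hx
          rw [e5, r5] at h
          rw [r1]
          push_cast at *
          linarith [d0.1, d0.2, d1.1, d1.2, d2.1, d2.2, d3.1, d3.2, d4.1, d4.2, d5.1, d5.2]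

/-- **Theorem (Abe–Tran, Theorem 1.8 for G₂).**
Let `Φ` be the root system of type `G₂`, with simple roots `a1` (short) and `a2`
(long). A subset `Σ ⊆ Φ⁺` is Worpitzky-compatible iff `Σ` is negatively coclosed
or `Σ = {a2} ∪ T` for some nonempty `T ⊆ {2a1+a2, 3a1+a2, 3a1+2a2}`. -/
theorem worpitzky_compatible_iff_G2
    (rs : RootSystemData 2) (a1 a2 : EucV 2)
    (hΔ : rs.Δ = {a1, a2}) (hlen : ⟪a1, a1⟫_ℝ < ⟪a2, a2⟫_ℝ)
    (hPos : rs.Pos = {a1, a2, a1 + a2, (2:ℝ) • a1 + a2, (3:ℝ) • a1 + a2,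
      (3:ℝ) • a1 + (2:ℝ) • a2})
    (S : Set (EucV 2)) (hS : S ⊆ rs.Pos) :
    WCompat Set.univ rs.Pos rs.Δ S ↔
      (NegCoclosed rs.Pos S ∨
        ∃ T : Set (EucV 2), T.Nonempty ∧
          T ⊆ {(2:ℝ) • a1 + a2, (3:ℝ) • a1 + a2, (3:ℝ) • a1 + (2:ℝ) • a2} ∧
          S = {a2} ∪ T) := by
  obtain ⟨hApos, hind, hG12, hG21, hG22, hinj, hsur⟩ := g2_setup rs a1 a2 hΔ hlen hPos
  clear hinj hsur
  have hcoef : ∀ k l k' l' : ℝ, k • a1 + l • a2 = k' • a1 + l' • a2 → k = k' ∧ l = l' := by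
    intro k l k' l' h
    have := hind (k - k') (l - l') (by rw [← sub_eq_zero.mpr h]; module)
    exact ⟨by linarith [this.1], by linarith [this.2]⟩
  rw [g2_wc rs a1 a2 hΔ hlen hPos S hS, g2_neg rs a1 a2 hΔ hlen hPos S hS]
  constructor
  · rintro ⟨c1, c2⟩
    by_cases hex : ((2:ℝ) • a1 + a2 ∈ S ∨ (3:ℝ) • a1 + a2 ∈ S ∨ (3:ℝ) • a1 + (2:ℝ) • a2 ∈ S →
          a1 ∈ S ∨ a1 + a2 ∈ S)
    · exact Or.inl ⟨c1, hex, c2⟩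
    · right
      push Not at hex
      obtain ⟨hor, n0, n2⟩ := hex
      have p1 : a2 ∈ S := by tauto
      have ne : ∀ k l : ℝ, k ≠ 0 → k • a1 + l • a2 ≠ a2 := by
        intro k l hk h
        exact hk (hcoef k l 0 1 (by rw [h]; module)).1
      have n3 : (2:ℝ) • a1 + a2 ≠ a2 := by simpa using ne 2 1 (by norm_num)
      have n4 : (3:ℝ) • a1 + a2 ≠ a2 := by simpa using ne 3 1 (by norm_num)
      have n5 : (3:ℝ) • a1 + (2:ℝ) • a2 ≠ a2 := ne 3 2 (by norm_num)
      refine ⟨S \ {a2}, ?_, ?_, ?_⟩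
      · rcases hor with h | h | h
        · exact ⟨_, h, n3⟩
        · exact ⟨_, h, n4⟩
        · exact ⟨_, h, n5⟩
      · rintro x ⟨hx, hx2⟩
        have := hS hx
        rw [hPos] at this
        rcases this with rfl | rfl | rfl | h
        · exact (n0 hx).elim
        · exact (hx2 rfl).elim
        · exact (n2 hx).elim
        · exact h
      · rw [Set.union_sdiff_cancel]
        simpa using p1
  · rintro (⟨c1, c2, c3⟩ | ⟨T, -, -, rfl⟩)
    · exact ⟨c1, c3⟩
    · have : a2 ∈ ({a2} ∪ T : Set (EucV 2)) := Or.inl rfl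
      tauto

end
end

section
/- Let Φ be an irreducible crystallographic root system of rank 2 of type A₂ or B₂ (i.e., |Φ⁺| ∈ {3,4}) with simple system Δ. Then a subset Σ ⊆ Φ⁺ is negatively coclosed if and only if either Σ = ∅ or Σ contains a simple root (Σ ∩ Δ ≠ ∅). -/
open scoped InnerProductSpace

noncomputable section

variable {ℓ : ℕ}

lemma exists_pair (rs : RootSystemData 2) :
    ∃ a b : EucV 2, a ≠ b ∧ rs.Δ = {a, b} ∧
      ∀ s t : ℝ, s • a + t • b = 0 → s = 0 ∧ t = 0 := by
  have hspan : ⊤ ≤ Submodule.span ℝ (Set.range (fun x : rs.Δ => (x : EucV 2))) := by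
    rw [← rs.spanning, Submodule.span_le, Subtype.range_coe]
    intro α hα
    have key : ∀ γ : EucV 2, IsNNIntComb rs.Δ γ → γ ∈ Submodule.span ℝ rs.Δ := by
      rintro γ ⟨s, c, hs, rfl⟩
      exact Submodule.sum_mem _ fun x hx =>
        Submodule.smul_mem _ _ (Submodule.subset_span (hs hx))
    rcases rs.pos_or_neg α hα with h | h
    · exact key _ h
    · have := Submodule.neg_mem _ (key _ h)
      simpa using this
  have B := Module.Basis.mk rs.simple_indep hspan
  have hc : rs.Δ.ncard = 2 := by
    have h1 := Module.finrank_eq_nat_card_basis B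
    rw [finrank_euclideanSpace_fin] at h1
    rw [← Nat.card_coe_set_eq]; exact h1.symm
  obtain ⟨a, b, hab, hΔ⟩ := Set.ncard_eq_two.1 hc
  refine ⟨a, b, hab, hΔ, ?_⟩
  have hli := rs.simple_indep
  have hp : LinearIndependent ℝ ![a, b] := by
    have ha : a ∈ rs.Δ := by simp [hΔ]
    have hb : b ∈ rs.Δ := by simp [hΔ]
    have := hli.comp (![⟨a, ha⟩, ⟨b, hb⟩] : Fin 2 → rs.Δ) (by
      intro i j hij
      fin_cases i <;> fin_cases j <;> simp_all)
    convert this using 1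
    ext i; fin_cases i <;> rfl
  exact LinearIndependent.pair_iff.1 hp

lemma comb_pair {a b : EucV 2} (hab : a ≠ b) (γ : EucV 2) :
    IsNNIntComb {a, b} γ ↔ ∃ m n : ℕ, γ = (m : ℝ) • a + (n : ℝ) • b := by
  classical
  constructor
  · rintro ⟨s, c, hs, rfl⟩
    refine ⟨if a ∈ s then c a else 0, if b ∈ s then c b else 0, ?_⟩
    have hs' : s ⊆ {a, b} := by
      intro x hx
      simpa using hs hx
    have : ∑ x ∈ s, (c x : ℝ) • x
        = ∑ x ∈ ({a, b} : Finset (EucV 2)), if x ∈ s then (c x : ℝ) • x else 0 := by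
      rw [← Finset.sum_filter]
      congr 1
      ext x
      simp only [Finset.mem_filter]
      exact ⟨fun h => ⟨hs' h, h⟩, fun h => h.2⟩
    rw [this, Finset.sum_pair hab]
    split_ifs <;> simp
  · rintro ⟨m, n, rfl⟩
    refine ⟨{a, b}, fun x => if x = a then m else n, by simp, ?_⟩
    rw [Finset.sum_pair hab]
    simp [hab.symm]

/-- Working data for a rank two system. -/
structure PairData (rs : RootSystemData 2) (a b : EucV 2) : Prop where
  ne : a ≠ b
  dl : rs.Δ = {a, b}
  ind : ∀ s t : ℝ, s • a + t • b = 0 → s = 0 ∧ t = 0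

namespace PairData

variable {rs : RootSystemData 2} {a b : EucV 2}

lemma symm (h : PairData rs a b) : PairData rs b a :=
  ⟨h.ne.symm, by rw [h.dl, Set.pair_comm], fun s t hst => (h.ind t s (by rw [add_comm]; exact hst)).symm⟩

lemma ha (h : PairData rs a b) : a ∈ rs.Φ := rs.simple_sub (by simp [h.dl])
lemma hb (h : PairData rs a b) : b ∈ rs.Φ := h.symm.ha

lemma inj (h : PairData rs a b) {x y z w : ℝ} (e : x • a + y • b = z • a + w • b) :
    x = z ∧ y = w := by
  have := h.ind (x - z) (y - w) (by
    rw [sub_smul, sub_smul]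
    have : x • a - z • a + (y • b - w • b) = (x • a + y • b) - (z • a + w • b) := by abel
    rw [this, e, sub_self])
  exact ⟨by linarith [this.1], by linarith [this.2]⟩

lemma mem_pos (h : PairData rs a b) {γ : EucV 2} :
    γ ∈ rs.Pos ↔ γ ∈ rs.Φ ∧ ∃ m n : ℕ, γ = (m : ℝ) • a + (n : ℝ) • b := by
  rw [← comb_pair h.ne, ← h.dl]; rfl

lemma sign (h : PairData rs a b) {x y : ℝ} (hm : x • a + y • b ∈ rs.Φ) :
    (0 ≤ x ∧ 0 ≤ y) ∨ (x ≤ 0 ∧ y ≤ 0) := by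
  rcases rs.pos_or_neg _ hm with hh | hh
  · rw [h.dl, comb_pair h.ne] at hh
    obtain ⟨m, n, e⟩ := hh
    obtain ⟨rfl, rfl⟩ := h.inj e
    left; constructor <;> positivity
  · rw [h.dl, comb_pair h.ne] at hh
    obtain ⟨m, n, e⟩ := hh
    have e' : (-x) • a + (-y) • b = (m : ℝ) • a + (n : ℝ) • b := by
      rw [← e, neg_smul, neg_smul, neg_add]
    obtain ⟨h1, h2⟩ := h.inj e'
    have := Nat.cast_nonneg (α := ℝ) m
    have := Nat.cast_nonneg (α := ℝ) n
    right; constructor <;> linarith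

lemma mem_pos_of (h : PairData rs a b) {x y : ℝ} (hm : x • a + y • b ∈ rs.Φ)
    (hp : 0 < x ∨ 0 < y) : x • a + y • b ∈ rs.Pos := by
  refine ⟨hm, ?_⟩
  rcases rs.pos_or_neg _ hm with hh | hh
  · exact hh
  · rw [h.dl, comb_pair h.ne] at hh
    obtain ⟨m, n, e⟩ := hh
    have e' : (-x) • a + (-y) • b = (m : ℝ) • a + (n : ℝ) • b := by
      rw [← e, neg_smul, neg_smul, neg_add]
    obtain ⟨h1, h2⟩ := h.inj e'
    have := Nat.cast_nonneg (α := ℝ) m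
    have := Nat.cast_nonneg (α := ℝ) n
    exfalso; rcases hp with hp | hp <;> linarith

lemma aa_pos (h : PairData rs a b) : 0 < ⟪a, a⟫_ℝ := by
  rw [real_inner_self_pos]
  rintro rfl
  exact rs.nonzero h.ha

/-- reflection in `a`, where `2⟪b,a⟫ = -p ⟪a,a⟫` -/
lemma refl (h : PairData rs a b) {p : ℝ} (hp : 2 * ⟪a, b⟫_ℝ = -p * ⟪a, a⟫_ℝ) {x y : ℝ}
    (hm : x • a + y • b ∈ rs.Φ) : (-x + p * y) • a + y • b ∈ rs.Φ := by
  have := rs.refl_mem a h.ha _ hm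
  have e : 2 * ⟪x • a + y • b, a⟫_ℝ / ⟪a, a⟫_ℝ = 2 * x - p * y := by
    rw [div_eq_iff h.aa_pos.ne', inner_add_left, real_inner_smul_left, real_inner_smul_left,
      real_inner_comm a b]
    linear_combination y * hp
  rw [e] at this
  convert this using 1
  module

lemma one_of (h : PairData rs a b) {x : ℝ} (hx : x • a + (0:ℝ) • b ∈ rs.Φ) : x = 1 ∨ x = -1 :=
  rs.reduced a h.ha x (by simpa using hx)

lemma one_of' (h : PairData rs a b) {x : ℝ} (hx : (0:ℝ) • a + x • b ∈ rs.Φ) : x = 1 ∨ x = -1 :=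
  rs.reduced b h.hb x (by simpa using hx)

lemma cart (h : PairData rs a b) (hirr : IrredSet rs.Φ) :
    ∃ p : ℕ, 0 < p ∧ 2 * ⟪a, b⟫_ℝ = -(p : ℝ) * ⟪a, a⟫_ℝ := by
  obtain ⟨n, hn⟩ := rs.cryst a h.ha b h.hb
  rw [real_inner_comm a b] at hn
  have hb' : (0:ℝ) • a + (1:ℝ) • b ∈ rs.Φ := by simpa using h.hb
  rcases lt_trichotomy n 0 with h0 | h0 | h0
  · refine ⟨(-n).toNat, by omega, ?_⟩
    have : (((-n).toNat : ℤ) : ℝ) = ((-n : ℤ) : ℝ) := by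
      rw [Int.toNat_of_nonneg (by omega)]
    rw [← Int.cast_natCast, this, hn]; push_cast; ring
  · exfalso
    subst h0
    have hz : ⟪a, b⟫_ℝ = 0 := by simpa using hn
    apply hirr
    refine ⟨{a, -a}, {b, -b}, by simp, by simp, ?_, ?_⟩
    · apply Set.Subset.antisymm
      · have key : ∀ x y : ℝ, x • a + y • b ∈ rs.Φ → x • a + y • b ∈ ({a, -a} ∪ {b, -b} : Set (EucV 2)) := by
          intro x y hxy
          have h2 := h.refl (p := 0) (by simp [hz]) hxy
          have hs1 := h.sign hxy
          have hs2 := h.sign h2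
          have : x = 0 ∨ y = 0 := by
            by_contra! hc
            rcases hs1 with ⟨u, v⟩ | ⟨u, v⟩ <;> rcases hs2 with ⟨u', v'⟩ | ⟨u', v'⟩
            · exact hc.1 (by linarith)
            · exact hc.2 (by linarith)
            · exact hc.2 (by linarith)
            · exact hc.1 (by linarith)
          rcases this with rfl | rfl
          · rcases h.one_of' hxy with rfl | rfl <;> simp
          · rcases h.one_of hxy with rfl | rfl <;> simp
        intro γ hγ
        rcases rs.pos_or_neg γ hγ with hh | hh
        · rw [h.dl, comb_pair h.ne] at hh
          obtain ⟨m, n, rfl⟩ := hh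
          exact key _ _ hγ
        · rw [h.dl, comb_pair h.ne] at hh
          obtain ⟨m, n, e⟩ := hh
          have e' : γ = (-m : ℝ) • a + (-n : ℝ) • b := by
            rw [← neg_neg γ, e]; module
          rw [e'] at hγ ⊢
          exact key _ _ hγ
      · rintro γ ((rfl | rfl) | (rfl | rfl))
        · exact h.ha
        · exact rs.neg_mem _ h.ha
        · exact h.hb
        · exact rs.neg_mem _ h.hb
    · rintro x (rfl | rfl) y (rfl | rfl) <;> simp [hz]
  · exfalso
    have h2 := h.refl (p := -n) (by rw [hn]; ring) hb'
    have : (0:ℝ) < n := by exact_mod_cast h0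
    rcases h.sign h2 with ⟨u, v⟩ | ⟨u, v⟩ <;> linarith

lemma pa (h : PairData rs a b) : (1:ℝ) • a + (0:ℝ) • b ∈ rs.Φ := by simpa using h.ha
lemma pb (h : PairData rs a b) : (0:ℝ) • a + (1:ℝ) • b ∈ rs.Φ := by simpa using h.hb

lemma refl' (h : PairData rs a b) {q : ℝ} (hq : 2 * ⟪a, b⟫_ℝ = -q * ⟪b, b⟫_ℝ) {x y : ℝ}
    (hm : x • a + y • b ∈ rs.Φ) : x • a + (-y + q * x) • b ∈ rs.Φ := by
  rw [add_comm] at hm ⊢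
  exact h.symm.refl (by rw [real_inner_comm]; exact hq) hm

lemma fin (rs : RootSystemData 2) : rs.Pos.Finite := rs.finite.subset fun _ h => h.1

/-- coordinates embedding -/
lemma card_le (h : PairData rs a b) (T : Finset (ℕ × ℕ))
    (hT : ∀ t ∈ T, (t.1 : ℝ) • a + (t.2 : ℝ) • b ∈ rs.Pos) : T.card ≤ rs.Pos.ncard := by
  have := Set.ncard_le_ncard_of_injOn (s := (T : Set (ℕ × ℕ))) (t := rs.Pos)
    (fun t => (t.1 : ℝ) • a + (t.2 : ℝ) • b) (fun t ht => hT t ht) (by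
      intro s _ t _ e
      obtain ⟨h1, h2⟩ := h.inj e
      exact Prod.ext (by exact_mod_cast h1) (by exact_mod_cast h2)) (fin rs)
  simpa using this

lemma nn (h : PairData rs a b) {m n : ℕ} (hm : (m : ℝ) • a + (n : ℝ) • b ∈ rs.Φ) :
    (m : ℝ) • a + (n : ℝ) • b ∈ rs.Pos := h.mem_pos.2 ⟨hm, m, n, rfl⟩

lemma main2 (h : PairData rs a b) (hc : rs.Pos.ncard ≤ 4)
    (hp : 2 * ⟪a, b⟫_ℝ = -2 * ⟪a, a⟫_ℝ) (hq : 2 * ⟪a, b⟫_ℝ = -1 * ⟪b, b⟫_ℝ)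
    {x y : EucV 2} (hx : x ∈ rs.Pos) (hy : y ∈ rs.Pos) (hxy : ⟪x, y⟫_ℝ < 0) :
    (x = a ∧ y = b) ∨ (x = b ∧ y = a) := by
  have e1 : ((2:ℕ):ℝ) • a + ((1:ℕ):ℝ) • b ∈ rs.Pos :=
    h.nn (by have := h.refl hp h.pb; norm_num at this ⊢; exact this)
  have e2 : ((1:ℕ):ℝ) • a + ((1:ℕ):ℝ) • b ∈ rs.Pos :=
    h.nn (by have := h.refl' hq h.pa; norm_num at this ⊢; exact this)
  have e3 : ((1:ℕ):ℝ) • a + ((0:ℕ):ℝ) • b ∈ rs.Pos := h.nn (by simpa using h.ha)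
  have e4 : ((0:ℕ):ℝ) • a + ((1:ℕ):ℝ) • b ∈ rs.Pos := h.nn (by simpa using h.hb)
  have key : ∀ z ∈ rs.Pos, z = a ∨ z = b ∨ z = a + b ∨ z = (2:ℝ) • a + b := by
    intro z hz
    obtain ⟨-, m, n, rfl⟩ := h.mem_pos.1 hz
    by_contra! hcon
    have := h.card_le {(2,1),(1,1),(1,0),(0,1),(m,n)} (by
      simp only [Finset.mem_insert, Finset.mem_singleton]
      rintro t (rfl | rfl | rfl | rfl | rfl) <;> assumption)
    have h5 : ({(2,1),(1,1),(1,0),(0,1),(m,n)} : Finset (ℕ × ℕ)).card = 5 := by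
      have n1 : ¬ (m = 2 ∧ n = 1) := by rintro ⟨rfl, rfl⟩; simp at hcon
      have n2 : ¬ (m = 1 ∧ n = 1) := by rintro ⟨rfl, rfl⟩; simp at hcon
      have n3 : ¬ (m = 1 ∧ n = 0) := by rintro ⟨rfl, rfl⟩; simp at hcon
      have n4 : ¬ (m = 0 ∧ n = 1) := by rintro ⟨rfl, rfl⟩; simp at hcon
      repeat rw [Finset.card_insert_of_notMem]
      · simp
      all_goals simp only [Finset.mem_insert, Finset.mem_singleton, Prod.mk.injEq]; omega
    omega
  have hba := real_inner_comm a b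
  have ap := h.aa_pos
  rcases key x hx with rfl | rfl | rfl | rfl <;> rcases key y hy with rfl | rfl | rfl | rfl <;>
    first
    | exact Or.inl ⟨rfl, rfl⟩
    | exact Or.inr ⟨rfl, rfl⟩
    | (exfalso
       try simp only [inner_add_left, inner_add_right, real_inner_smul_left,
         real_inner_smul_right] at hxy
       linarith)

lemma main1 (h : PairData rs a b) (hc : rs.Pos.ncard ≤ 4)
    (hp : 2 * ⟪a, b⟫_ℝ = -1 * ⟪a, a⟫_ℝ) (hq : 2 * ⟪a, b⟫_ℝ = -1 * ⟪b, b⟫_ℝ)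
    {x y : EucV 2} (hx : x ∈ rs.Pos) (hy : y ∈ rs.Pos) (hxy : ⟪x, y⟫_ℝ < 0) :
    (x = a ∧ y = b) ∨ (x = b ∧ y = a) := by
  have e2 : ((1:ℕ):ℝ) • a + ((1:ℕ):ℝ) • b ∈ rs.Pos :=
    h.nn (by have := h.refl' hq h.pa; norm_num at this ⊢; exact this)
  have e3 : ((1:ℕ):ℝ) • a + ((0:ℕ):ℝ) • b ∈ rs.Pos := h.nn (by simpa using h.ha)
  have e4 : ((0:ℕ):ℝ) • a + ((1:ℕ):ℝ) • b ∈ rs.Pos := h.nn (by simpa using h.hb)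
  have key : ∀ z ∈ rs.Pos, z = a ∨ z = b ∨ z = a + b := by
    intro z hz
    obtain ⟨hz', m, n, rfl⟩ := h.mem_pos.1 hz
    by_contra! hcon
    have n2 : ¬ (m = 1 ∧ n = 1) := by rintro ⟨rfl, rfl⟩; simp at hcon
    have n3 : ¬ (m = 1 ∧ n = 0) := by rintro ⟨rfl, rfl⟩; simp at hcon
    have n4 : ¬ (m = 0 ∧ n = 1) := by rintro ⟨rfl, rfl⟩; simp at hcon
    have key2 : ∀ m' n' : ℕ, (m' : ℝ) • a + (n' : ℝ) • b ∈ rs.Pos →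
        (m' = 1 ∧ n' = 1) ∨ (m' = 1 ∧ n' = 0) ∨ (m' = 0 ∧ n' = 1) ∨ (m' = m ∧ n' = n) := by
      intro m' n' hz2
      by_contra! hcon2
      have := h.card_le {(1,1),(1,0),(0,1),(m',n'),(m,n)} (by
        simp only [Finset.mem_insert, Finset.mem_singleton]
        rintro t (rfl | rfl | rfl | rfl | rfl) <;> assumption)
      have h5 : ({(1,1),(1,0),(0,1),(m',n'),(m,n)} : Finset (ℕ × ℕ)).card = 5 := by
        repeat rw [Finset.card_insert_of_notMem]
        · simp
        all_goals simp only [Finset.mem_insert, Finset.mem_singleton, Prod.mk.injEq]; omega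
      omega
    have m0 : 0 < m := by
      rcases Nat.eq_zero_or_pos m with rfl | hm
      · rcases h.one_of' (by simpa using hz') with h1 | h1
        · exact absurd ⟨rfl, by exact_mod_cast h1⟩ n4
        · have := Nat.cast_nonneg (α := ℝ) n; linarith
      · exact hm
    have n0 : 0 < n := by
      rcases Nat.eq_zero_or_pos n with rfl | hm
      · rcases h.one_of (by simpa using hz') with h1 | h1
        · exact absurd ⟨by exact_mod_cast h1, rfl⟩ n3
        · have := Nat.cast_nonneg (α := ℝ) m; linarith
      · exact hm
    have m0' : (0:ℝ) < m := by exact_mod_cast m0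
    have n0' : (0:ℝ) < n := by exact_mod_cast n0
    have r1 := h.refl hp hz'
    have r2 := h.refl' hq hz'
    have s1 : (0:ℝ) ≤ -m + 1 * n := by rcases h.sign r1 with hh | hh <;> linarith
    have s2 : (0:ℝ) ≤ -n + 1 * m := by rcases h.sign r2 with hh | hh <;> linarith
    have : (m:ℝ) = n := by linarith
    have hmn : m = n := by exact_mod_cast this
    subst hmn
    have r3 := key2 0 m (h.nn (by convert r1 using 3; simp))
    omega
  have hba := real_inner_comm a b
  have ap := h.aa_pos
  rcases key x hx with rfl | rfl | rfl <;> rcases key y hy with rfl | rfl | rfl <;>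
    first
    | exact Or.inl ⟨rfl, rfl⟩
    | exact Or.inr ⟨rfl, rfl⟩
    | (exfalso
       try simp only [inner_add_left, inner_add_right, real_inner_smul_left,
         real_inner_smul_right] at hxy
       linarith)

lemma main (h : PairData rs a b) (hirr : IrredSet rs.Φ) (hc : rs.Pos.ncard ≤ 4)
    {x y : EucV 2} (hx : x ∈ rs.Pos) (hy : y ∈ rs.Pos) (hxy : ⟪x, y⟫_ℝ < 0) :
    (x = a ∧ y = b) ∨ (x = b ∧ y = a) := by
  obtain ⟨p, p0, hp⟩ := h.cart hirr
  obtain ⟨q, q0, hq⟩ := h.symm.cart hirr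
  have hq' := hq
  rw [real_inner_comm] at hq
  have hpq : p * q ≤ 2 := by
    by_contra! hcon
    obtain ⟨r, hr⟩ : ∃ r, p * q = r + 1 := ⟨p * q - 1, by omega⟩
    have e1 : ((p:ℕ):ℝ) • a + ((1:ℕ):ℝ) • b ∈ rs.Pos :=
      h.nn (by have := h.refl hp h.pb; norm_num at this ⊢; exact this)
    have e2' : ((1:ℕ):ℝ) • a + ((q:ℕ):ℝ) • b ∈ rs.Φ := by
      have := h.refl' hq h.pa; norm_num at this ⊢; exact this
    have e2 := h.nn e2'
    have e3 : ((1:ℕ):ℝ) • a + ((0:ℕ):ℝ) • b ∈ rs.Pos := h.nn (by simpa using h.ha)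
    have e4 : ((0:ℕ):ℝ) • a + ((1:ℕ):ℝ) • b ∈ rs.Pos := h.nn (by simpa using h.hb)
    have e5 : ((r:ℕ):ℝ) • a + ((q:ℕ):ℝ) • b ∈ rs.Pos :=
      h.nn (by
        have := h.refl hp e2'
        convert this using 3
        have : (p:ℝ) * q = r + 1 := by exact_mod_cast hr
        push_cast; linarith)
    have := h.card_le {(p,1),(1,q),(1,0),(0,1),(r,q)} (by
      simp only [Finset.mem_insert, Finset.mem_singleton]
      rintro t (rfl | rfl | rfl | rfl | rfl) <;> assumption)
    have k1 : ¬ (p = 1 ∧ q = 1) := by rintro ⟨rfl, rfl⟩; omega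
    have k2 : ¬ (p = r ∧ q = 1) := by rintro ⟨rfl, rfl⟩; omega
    have h5 : ({(p,1),(1,q),(1,0),(0,1),(r,q)} : Finset (ℕ × ℕ)).card = 5 := by
      repeat rw [Finset.card_insert_of_notMem]
      · simp
      all_goals simp only [Finset.mem_insert, Finset.mem_singleton, Prod.mk.injEq]; omega
    omega
  have p2 : p ≤ 2 := by nlinarith
  have q2 : q ≤ 2 := by nlinarith
  interval_cases p <;> interval_cases q
  · exact h.main1 hc (by simpa using hp) (by simpa using hq) hx hy hxy
  · exact (h.symm.main2 hc (by simpa using hq') (by rw [real_inner_comm]; simpa using hp) hx hy hxy).symm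
  · exact h.main2 hc (by simpa using hp) (by simpa using hq) hx hy hxy
  · omega

end PairData

/-- Let `Φ` be an irreducible crystallographic root system of rank 2 of type `A₂`
or `B₂` (i.e. `|Φ⁺| ∈ {3,4}`). A subset `Σ ⊆ Φ⁺` is negatively coclosed iff
`Σ = ∅` or `Σ` contains a simple root. -/
theorem rank_two_negatively_coclosed_iff_simple
    (rs : RootSystemData 2) (hirr : IrredSet rs.Φ)
    (hcard : rs.Pos.ncard = 3 ∨ rs.Pos.ncard = 4)
    (S : Set (EucV 2)) (hS : S ⊆ rs.Pos) :
    NegCoclosed rs.Pos S ↔ (S = ∅ ∨ (S ∩ rs.Δ).Nonempty) := by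
  obtain ⟨a, b, hab, hΔ, hind⟩ := exists_pair rs
  have h : PairData rs a b := ⟨hab, hΔ, hind⟩
  have hc : rs.Pos.ncard ≤ 4 := by omega
  have haP : a ∈ rs.Pos := h.mem_pos.2 ⟨h.ha, 1, 0, by simp⟩
  have hbP : b ∈ rs.Pos := h.mem_pos.2 ⟨h.hb, 0, 1, by simp⟩
  constructor
  · intro hN
    rcases S.eq_empty_or_nonempty with hE | ⟨γ, hγ⟩
    · exact Or.inl hE
    right
    have fin : a ∈ S ∨ b ∈ S → (S ∩ rs.Δ).Nonempty := by
      rintro (hh | hh)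
      · exact ⟨a, hh, by simp [hΔ]⟩
      · exact ⟨b, hh, by simp [hΔ]⟩
    apply fin
    obtain ⟨hΦ, m, n, e⟩ := h.mem_pos.1 (hS hγ)
    rcases Nat.eq_zero_or_pos m with rfl | hm
    · rw [e] at hΦ
      rcases h.one_of' (by simpa using hΦ) with h1 | h1
      · right; rw [h1] at e; simp at e; rwa [← e]
      · have := Nat.cast_nonneg (α := ℝ) n; linarith
    rcases Nat.eq_zero_or_pos n with rfl | hn
    · rw [e] at hΦ
      rcases h.one_of (by simpa using hΦ) with h1 | h1
      · left; rw [h1] at e; simp at e; rwa [← e]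
      · have := Nat.cast_nonneg (α := ℝ) m; linarith
    refine hN γ hγ a haP b hbP m n (by exact_mod_cast hm) (by exact_mod_cast hn)
      (by simpa using e) ?_
    obtain ⟨p, p0, hp⟩ := h.cart hirr
    have : (0:ℝ) < p := by exact_mod_cast p0
    have := mul_pos this h.aa_pos
    linarith
  · rintro (rfl | ⟨γ, hγS, hγ⟩)
    · intro α hα; exact absurd hα (Set.notMem_empty _)
    · intro α _ β₁ h1 β₂ h2 d₁ d₂ _ _ _ hneg
      rw [hΔ] at hγ
      rcases h.main hirr hc h1 h2 hneg with ⟨rfl, rfl⟩ | ⟨rfl, rfl⟩ <;>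
        rcases hγ with rfl | rfl <;> simp [hγS]

end
end

section
/- Let Φ be an irreducible crystallographic root system of rank 2 of type A₂ or B₂ (i.e., |Φ⁺| ∈ {3,4}) with simple system Δ. Then a subset Σ ⊆ Φ⁺ is Worpitzky-compatible if and only if either Σ = ∅ or Σ contains a simple root (Σ ∩ Δ ≠ ∅). -/
open scoped InnerProductSpace

noncomputable section

variable {ℓ : ℕ}

lemma w_injcoord {a b : EucV 2} (h : Submodule.span ℝ {a, b} = ⊤) {x y : EucV 2}
    (h1 : ⟪a, x⟫_ℝ = ⟪a, y⟫_ℝ) (h2 : ⟪b, x⟫_ℝ = ⟪b, y⟫_ℝ) : x = y := by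
  have h3 : ∀ z ∈ Submodule.span ℝ {a, b}, ⟪z, x - y⟫_ℝ = 0 := by
    intro z hz
    induction hz using Submodule.span_induction with
    | mem z hz =>
      rcases hz with rfl | hz
      · rw [inner_sub_right]; linarith
      · rw [Set.mem_singleton_iff] at hz; subst hz; rw [inner_sub_right]; linarith
    | zero => simp
    | add u v _ _ hu hv => rw [inner_add_left, hu, hv]; simp
    | smul c u _ hu => rw [inner_smul_left, hu]; simp
  have h4 := h3 (x - y) (by rw [h]; trivial)
  exact sub_eq_zero.mp (inner_self_eq_zero.mp h4)

lemma w_surjcoord {a b : EucV 2} (h : Submodule.span ℝ {a, b} = ⊤) (u v : ℝ) :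
    ∃ x : EucV 2, ⟪a, x⟫_ℝ = u ∧ ⟪b, x⟫_ℝ = v := by
  let f : EucV 2 →ₗ[ℝ] (ℝ × ℝ) := (innerₛₗ ℝ a).prod (innerₛₗ ℝ b)
  have hf : Function.Injective f := by
    intro x y hxy
    have := Prod.ext_iff.mp hxy
    exact w_injcoord h this.1 this.2
  have hs : Function.Surjective f := by
    refine (LinearMap.injective_iff_surjective_of_finrank_eq_finrank ?_).mp hf
    simp
  obtain ⟨x, hx⟩ := hs (u, v)
  have := Prod.ext_iff.mp hx
  exact ⟨x, this.1, this.2⟩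

lemma w_alcove_eq {P A : Set (EucV 2)} (hA : IsAlcove Set.univ P A) {r : EucV 2 → ℤ}
    (hr : IsAddress P A r) :
    A = {x | ∀ γ ∈ P, ((r γ : ℝ) - 1 < ⟪γ, x⟫_ℝ ∧ ⟪γ, x⟫_ℝ < (r γ : ℝ))} := by
  obtain ⟨x, hx, rfl⟩ := hA
  apply Set.Subset.antisymm
  · intro y hy γ hγ
    exact hr γ hγ y hy
  · apply IsPreconnected.subset_connectedComponentIn
    · apply Convex.isPreconnected
      intro y hy z hz s t hs ht hst γ hγ
      have h1 := hy γ hγ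
      have h2 := hz γ hγ
      rw [inner_add_right, inner_smul_right, inner_smul_right]
      have hs' : s = 1 - t := by linarith
      subst hs'
      rcases hs.lt_or_eq with h | h
      · constructor <;> nlinarith
      · have : t = 1 := by linarith
        subst this
        constructor <;> linarith
    · intro γ hγ
      exact hr γ hγ x (mem_connectedComponentIn hx)
    · rintro y hy
      refine ⟨trivial, ?_⟩
      rintro ⟨_, γ, hγ, n, hn⟩
      have := hy γ hγ
      rw [hn] at this
      have h1 : r γ - 1 < n := by exact_mod_cast this.1
      have h2 : n < r γ := by exact_mod_cast this.2
      omega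

lemma w_closure_le {P A : Set (EucV 2)} {r : EucV 2 → ℤ} (hr : IsAddress P A r)
    {x : EucV 2} (hx : x ∈ closure A) {γ : EucV 2} (hγ : γ ∈ P) : ⟪γ, x⟫_ℝ ≤ r γ := by
  have hc : IsClosed {x : EucV 2 | ⟪γ, x⟫_ℝ ≤ r γ} :=
    isClosed_le (by fun_prop) continuous_const
  exact closure_minimal (fun y hy => (hr γ hγ y hy).2.le) hc hx

lemma w_mem_closure {P A : Set (EucV 2)} (hA : IsAlcove Set.univ P A) {r : EucV 2 → ℤ}
    (hr : IsAddress P A r) {y : EucV 2}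
    (hy : ∀ γ ∈ P, ((r γ : ℝ) - 1 ≤ ⟪γ, y⟫_ℝ ∧ ⟪γ, y⟫_ℝ ≤ (r γ : ℝ))) : y ∈ closure A := by
  have hE := w_alcove_eq hA hr
  obtain ⟨x, hx, hAx⟩ := hA
  have hxA : x ∈ A := by rw [hAx]; exact mem_connectedComponentIn hx
  have hsub : openSegment ℝ x y ⊆ A := by
    rintro z ⟨s, t, hs, ht, hst, rfl⟩
    rw [hE]
    intro γ hγ
    have h1 := hr γ hγ x hxA
    have h2 := hy γ hγ
    rw [inner_add_right, inner_smul_right, inner_smul_right]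
    have hs' : t = 1 - s := by linarith
    subst hs'
    constructor <;> nlinarith
  apply closure_mono hsub
  rw [closure_openSegment]
  exact right_mem_segment ℝ x y

lemma w_address {P : Set (EucV 2)} {x : EucV 2} (hx : x ∈ Set.univ \ hypUnion Set.univ P) :
    IsAddress P (connectedComponentIn (Set.univ \ hypUnion Set.univ P) x)
      (fun γ => ⌈⟪γ, x⟫_ℝ⌉) := by
  intro γ hγ y hy
  have hpc : IsPreconnected (connectedComponentIn (Set.univ \ hypUnion Set.univ P) x) :=
    isPreconnected_connectedComponentIn
  have him := (hpc.image (fun z => ⟪γ, z⟫_ℝ) (by fun_prop)).ordConnected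
  have hno : ∀ n : ℤ, (n : ℝ) ∉ (fun z => ⟪γ, z⟫_ℝ) ''
      (connectedComponentIn (Set.univ \ hypUnion Set.univ P) x) := by
    rintro n ⟨z, hz, hzn⟩
    exact (connectedComponentIn_subset _ _ hz).2 ⟨trivial, γ, hγ, n, hzn⟩
  have hxm := Set.mem_image_of_mem (fun z => ⟪γ, z⟫_ℝ) (mem_connectedComponentIn hx)
  have hym := Set.mem_image_of_mem (fun z => ⟪γ, z⟫_ℝ) hy
  have h1 := Int.le_ceil ⟪γ, x⟫_ℝ
  have h2 := Int.ceil_lt_add_one ⟪γ, x⟫_ℝ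
  constructor
  · by_contra hcon
    apply hno (⌈⟪γ, x⟫_ℝ⌉ - 1)
    apply him.out hym hxm
    push_cast
    constructor
    · simpa using hcon
    · show _ ≤ ⟪γ, x⟫_ℝ
      linarith
  · by_contra hcon
    apply hno (⌈⟪γ, x⟫_ℝ⌉)
    apply him.out hxm hym
    constructor
    · exact h1
    · simpa using hcon

lemma w_wall {a b : EucV 2} (h : Submodule.span ℝ {a, b} = ⊤) {P A : Set (EucV 2)}
    (hA : IsAlcove Set.univ P A) {r : EucV 2 → ℤ} (hr : IsAddress P A r)
    (β : EucV 2) (i j : ℝ) (hβ : β = i • a + j • b) (hij : i ≠ 0 ∨ j ≠ 0) (m : ℤ)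
    (u v u' v' : ℝ) (hne : u ≠ u' ∨ v ≠ v')
    (h1 : i * u + j * v = m) (h2 : i * u' + j * v' = m)
    (hc : ∀ p : EucV 2, ⟪a, p⟫_ℝ = u → ⟪b, p⟫_ℝ = v →
      ∀ γ ∈ P, ((r γ : ℝ) - 1 ≤ ⟪γ, p⟫_ℝ ∧ ⟪γ, p⟫_ℝ ≤ (r γ : ℝ)))
    (hc' : ∀ p : EucV 2, ⟪a, p⟫_ℝ = u' → ⟪b, p⟫_ℝ = v' →
      ∀ γ ∈ P, ((r γ : ℝ) - 1 ≤ ⟪γ, p⟫_ℝ ∧ ⟪γ, p⟫_ℝ ≤ (r γ : ℝ))) :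
    IsWall Set.univ β m A := by
  obtain ⟨p, hp1, hp2⟩ := w_surjcoord h u v
  obtain ⟨q, hq1, hq2⟩ := w_surjcoord h u' v'
  intro y _ hy
  have hin : ∀ z : EucV 2, ⟪β, z⟫_ℝ = i * ⟪a, z⟫_ℝ + j * ⟪b, z⟫_ℝ := by
    intro z; rw [hβ, inner_add_left, inner_smul_left, inner_smul_left]; simp
  have hpm : p ∈ {x ∈ Set.univ | ⟪β, x⟫_ℝ = (m : ℝ)} ∩ closure A :=
    ⟨⟨trivial, by rw [hin, hp1, hp2, h1]⟩, w_mem_closure hA hr (hc p hp1 hp2)⟩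
  have hqm : q ∈ {x ∈ Set.univ | ⟪β, x⟫_ℝ = (m : ℝ)} ∩ closure A :=
    ⟨⟨trivial, by rw [hin, hq1, hq2, h2]⟩, w_mem_closure hA hr (hc' q hq1 hq2)⟩
  rw [hin] at hy
  have key : ∃ t : ℝ, ⟪a, y⟫_ℝ = u + t * (u' - u) ∧ ⟪b, y⟫_ℝ = v + t * (v' - v) := by
    generalize ⟪a, y⟫_ℝ = s at hy
    generalize ⟪b, y⟫_ℝ = w at hy
    have cross : (s - u) * (v' - v) = (w - v) * (u' - u) := by
      rcases hij with hi | hj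
      · apply mul_left_cancel₀ hi
        linear_combination (v' - v) * (hy - h1) - (w - v) * (h2 - h1)
      · apply mul_left_cancel₀ hj
        linear_combination -(u' - u) * (hy - h1) + (s - u) * (h2 - h1)
    by_cases hu : u = u'
    · have hv : v' - v ≠ 0 := by
        rcases hne with h | h
        · exact absurd hu h
        · exact fun h' => h (by linarith)
      refine ⟨(w - v) / (v' - v), ?_, ?_⟩
      · field_simp
        linear_combination cross
      · field_simp
        ring
    · have hu' : u' - u ≠ 0 := fun h' => hu (by linarith)
      refine ⟨(s - u) / (u' - u), ?_, ?_⟩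
      · field_simp
        ring
      · field_simp
        linear_combination -cross
  obtain ⟨t, ht1, ht2⟩ := key
  have hyt : y = AffineMap.lineMap p q t := by
    rw [AffineMap.lineMap_apply_module']
    apply w_injcoord h
    · rw [ht1, inner_add_right, inner_smul_right, inner_sub_right, hp1, hq1]; ring
    · rw [ht2, inner_add_right, inner_smul_right, inner_sub_right, hp2, hq2]; ring
  rw [hyt]
  exact AffineMap.lineMap_mem _ (subset_affineSpan ℝ _ hpm) (subset_affineSpan ℝ _ hqm)

lemma w_red {P A S : Set (EucV 2)} {r : EucV 2 → ℤ} (hr : IsAddress P A r)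
    {α : EucV 2} (hα : α ∈ P) (n : ℤ)
    (hgoal : n = r α → ∀ x, x ∈ upperClos P A r → ⟪α, x⟫_ℝ = (r α : ℝ) →
      ∃ β ∈ S, 1 ≤ r β ∧ IsWall Set.univ β (r β) A ∧
          ∀ x ∈ upperClos P A r, ⟪α, x⟫_ℝ = (r α : ℝ) → ⟪β, x⟫_ℝ = (r β : ℝ)) :
    upperClos P A r ∩ {x : EucV 2 | ⟪α, x⟫_ℝ = (n : ℝ)} = ∅ ∨
        ∃ β ∈ S, ∃ m : ℤ, m = r β ∧ 1 ≤ m ∧ IsWall Set.univ β m A ∧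
          upperClos P A r ∩ {x : EucV 2 | ⟪α, x⟫_ℝ = (n : ℝ)} ⊆
            {x : EucV 2 | ⟪β, x⟫_ℝ = (m : ℝ)} := by
  rcases Set.eq_empty_or_nonempty
    (upperClos P A r ∩ {x : EucV 2 | ⟪α, x⟫_ℝ = (n : ℝ)}) with h | ⟨x, hx, hxn⟩
  · exact Or.inl h
  right
  have hxn : ⟪α, x⟫_ℝ = (n : ℝ) := hxn
  have h1 := hx.2 α hα
  have h2 := w_closure_le hr hx.1 hα
  rw [hxn] at h1 h2
  have h1' : r α - 1 < n := by exact_mod_cast h1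
  have h2' : n ≤ r α := by exact_mod_cast h2
  have hn : n = r α := by omega
  obtain ⟨β, hβ, h1β, hw, hsub⟩ := hgoal hn x hx (by rw [hxn, hn])
  exact ⟨β, hβ, r β, rfl, h1β, hw, fun y hy => hsub y hy.1 (by rw [← hn]; exact hy.2)⟩

lemma w_simple_one {P D A : Set (EucV 2)} (hA : IsAlcove Set.univ P A)
    (hAD : A ⊆ fundPar Set.univ D) {r : EucV 2 → ℤ} (hr : IsAddress P A r) {a : EucV 2}
    (haP : a ∈ P) (haD : a ∈ D) : r a = 1 := by
  obtain ⟨x, hx, hAx⟩ := hA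
  have hxA : x ∈ A := by rw [hAx]; exact mem_connectedComponentIn hx
  have h1 := hr a haP x hxA
  have h2 := (hAD hxA).2 a haD
  have h3 : ((0:ℤ):ℝ) < r a := by push_cast; linarith
  have h4 : ((r a : ℤ):ℝ) < (2:ℤ) := by push_cast; linarith
  have h3 := Int.cast_lt.mp h3
  have h4 := Int.cast_lt.mp h4
  omega

lemma w_wallA {a b : EucV 2} (h : Submodule.span ℝ {a, b} = ⊤) {A : Set (EucV 2)}
    (hA : IsAlcove Set.univ {a, b, a + b} A) {r : EucV 2 → ℤ}
    (hr : IsAddress {a, b, a + b} A r) (k : ℤ) (hra : r a = 1) (hrb : r b = 1)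
    (hrc : r (a + b) = k)
    (β : EucV 2) (i j : ℝ) (hβ : β = i • a + j • b) (hij : i ≠ 0 ∨ j ≠ 0) (m : ℤ)
    (u v u' v' : ℝ) (hne : u ≠ u' ∨ v ≠ v')
    (h1 : i * u + j * v = m) (h2 : i * u' + j * v' = m)
    (hc : 0 ≤ u ∧ u ≤ 1 ∧ 0 ≤ v ∧ v ≤ 1 ∧ k - 1 ≤ u + v ∧ u + v ≤ k)
    (hc' : 0 ≤ u' ∧ u' ≤ 1 ∧ 0 ≤ v' ∧ v' ≤ 1 ∧ k - 1 ≤ u' + v' ∧ u' + v' ≤ k) :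
    IsWall Set.univ β m A := by
  have key : ∀ u v : ℝ, (0 ≤ u ∧ u ≤ 1 ∧ 0 ≤ v ∧ v ≤ 1 ∧ k - 1 ≤ u + v ∧ u + v ≤ k) →
      ∀ p : EucV 2, ⟪a, p⟫_ℝ = u → ⟪b, p⟫_ℝ = v →
      ∀ γ ∈ ({a, b, a + b} : Set (EucV 2)),
        ((r γ : ℝ) - 1 ≤ ⟪γ, p⟫_ℝ ∧ ⟪γ, p⟫_ℝ ≤ (r γ : ℝ)) := by
    rintro u v ⟨c1, c2, c3, c4, c5, c6⟩ p hp1 hp2 γ (rfl | rfl | rfl)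
    · rw [hra, hp1]; push_cast; constructor <;> linarith
    · rw [hrb, hp2]; push_cast; constructor <;> linarith
    · rw [hrc, inner_add_left, hp1, hp2]; constructor <;> linarith
  exact w_wall h hA hr β i j hβ hij m u v u' v' hne h1 h2 (key u v hc) (key u' v' hc')

lemma w_wallB {a b : EucV 2} (h : Submodule.span ℝ {a, b} = ⊤) {A : Set (EucV 2)}
    (hA : IsAlcove Set.univ {a, b, a + b, (2 : ℝ) • a + b} A) {r : EucV 2 → ℤ}
    (hr : IsAddress {a, b, a + b, (2 : ℝ) • a + b} A r) (k l : ℤ)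
    (hra : r a = 1) (hrb : r b = 1)
    (hrc : r (a + b) = k) (hrd : r ((2 : ℝ) • a + b) = l)
    (β : EucV 2) (i j : ℝ) (hβ : β = i • a + j • b) (hij : i ≠ 0 ∨ j ≠ 0) (m : ℤ)
    (u v u' v' : ℝ) (hne : u ≠ u' ∨ v ≠ v')
    (h1 : i * u + j * v = m) (h2 : i * u' + j * v' = m)
    (hc : 0 ≤ u ∧ u ≤ 1 ∧ 0 ≤ v ∧ v ≤ 1 ∧ k - 1 ≤ u + v ∧ u + v ≤ k ∧
      l - 1 ≤ 2 * u + v ∧ 2 * u + v ≤ l)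
    (hc' : 0 ≤ u' ∧ u' ≤ 1 ∧ 0 ≤ v' ∧ v' ≤ 1 ∧ k - 1 ≤ u' + v' ∧ u' + v' ≤ k ∧
      l - 1 ≤ 2 * u' + v' ∧ 2 * u' + v' ≤ l) :
    IsWall Set.univ β m A := by
  have key : ∀ u v : ℝ, (0 ≤ u ∧ u ≤ 1 ∧ 0 ≤ v ∧ v ≤ 1 ∧ k - 1 ≤ u + v ∧ u + v ≤ k ∧
      l - 1 ≤ 2 * u + v ∧ 2 * u + v ≤ l) →
      ∀ p : EucV 2, ⟪a, p⟫_ℝ = u → ⟪b, p⟫_ℝ = v →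
      ∀ γ ∈ ({a, b, a + b, (2 : ℝ) • a + b} : Set (EucV 2)),
        ((r γ : ℝ) - 1 ≤ ⟪γ, p⟫_ℝ ∧ ⟪γ, p⟫_ℝ ≤ (r γ : ℝ)) := by
    rintro u v ⟨c1, c2, c3, c4, c5, c6, c7, c8⟩ p hp1 hp2 γ (rfl | rfl | rfl | rfl)
    · rw [hra, hp1]; push_cast; constructor <;> linarith
    · rw [hrb, hp2]; push_cast; constructor <;> linarith
    · rw [hrc, inner_add_left, hp1, hp2]; constructor <;> linarith
    · rw [hrd, inner_add_left, real_inner_smul_left, hp1, hp2]; constructor <;> linarith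
  exact w_wall h hA hr β i j hβ hij m u v u' v' hne h1 h2 (key u v hc) (key u' v' hc')

lemma w_bwdA {a b : EucV 2} (h : Submodule.span ℝ {a, b} = ⊤) {S : Set (EucV 2)}
    (hS : S ⊆ {a, b, a + b}) (hab : a ∈ S ∨ b ∈ S) :
    WCompat Set.univ {a, b, a + b} {a, b} S := by
  intro A hA hAD r hr α hα n
  have hra : r a = 1 := w_simple_one hA hAD hr (by simp) (by simp)
  have hrb : r b = 1 := w_simple_one hA hAD hr (by simp) (by simp)
  have hk : ∃ k, r (a + b) = k := ⟨_, rfl⟩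
  obtain ⟨k, hrc⟩ := hk
  have hup : ∀ x ∈ upperClos {a, b, a + b} A r, 0 < ⟪a, x⟫_ℝ ∧ ⟪a, x⟫_ℝ ≤ 1 ∧
      0 < ⟪b, x⟫_ℝ ∧ ⟪b, x⟫_ℝ ≤ 1 ∧ k - 1 < ⟪a, x⟫_ℝ + ⟪b, x⟫_ℝ ∧
      ⟪a, x⟫_ℝ + ⟪b, x⟫_ℝ ≤ k := by
    intro x hx
    have a1 := hx.2 a (by simp)
    have a2 := w_closure_le hr hx.1 (γ := a) (by simp)
    have b1 := hx.2 b (by simp)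
    have b2 := w_closure_le hr hx.1 (γ := b) (by simp)
    have c1 := hx.2 (a + b) (by simp)
    have c2 := w_closure_le hr hx.1 (γ := a + b) (by simp)
    rw [hra] at a1 a2
    rw [hrb] at b1 b2
    rw [hrc, inner_add_left] at c1 c2
    push_cast at a1 a2 b1 b2
    exact ⟨by linarith, a2, by linarith, b2, c1, c2⟩
  have hk12 : k = 1 ∨ k = 2 := by
    obtain ⟨x, hx, hAx⟩ := id hA
    have hxA : x ∈ A := by rw [hAx]; exact mem_connectedComponentIn hx
    have h1 := hr a (by simp) x hxA
    have h2 := hr b (by simp) x hxA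
    have h3 := hr (a + b) (by simp) x hxA
    rw [hra] at h1
    rw [hrb] at h2
    rw [hrc, inner_add_left] at h3
    push_cast at h1 h2
    have h4 : ((0:ℤ):ℝ) < k := by push_cast; linarith
    have h5 : (k:ℝ) < (3:ℤ) := by push_cast; linarith
    have h4 := Int.cast_lt.mp h4
    have h5 := Int.cast_lt.mp h5
    omega
  have W := w_wallA h hA hr k hra hrb hrc
  apply w_red hr (hS hα) n
  intro _ x hx hxα
  have hux := hup x hx
  rcases hk12 with rfl | rfl
  · rcases hS hα with rfl | rfl | rfl
    · exfalso; rw [hra] at hxα; push_cast at *; linarith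
    · exfalso; rw [hrb] at hxα; push_cast at *; linarith
    · refine ⟨_, hα, by omega, ?_, fun _ _ h => h⟩
      rw [hrc]
      exact W _ 1 1 (by simp) (by simp) _ 1 0 0 1 (by simp) (by simp) (by simp)
        (by norm_num) (by norm_num)
  · have wa : IsWall Set.univ a (r a) A := by
      rw [hra]
      exact W _ 1 0 (by simp) (by simp) _ 1 0 1 1 (by simp) (by simp) (by simp)
        (by norm_num) (by norm_num)
    have wb : IsWall Set.univ b (r b) A := by
      rw [hrb]
      exact W _ 0 1 (by simp) (by simp) _ 0 1 1 1 (by simp) (by simp) (by simp)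
        (by norm_num) (by norm_num)
    rcases hS hα with rfl | rfl | rfl
    · exact ⟨_, hα, by omega, wa, fun _ _ h => h⟩
    · exact ⟨_, hα, by omega, wb, fun _ _ h => h⟩
    · rcases hab with hs | hs
      · refine ⟨_, hs, by omega, wa, fun y hy hyc => ?_⟩
        have := hup y hy
        rw [hrc, inner_add_left] at hyc
        rw [hra]; push_cast at *; linarith
      · refine ⟨_, hs, by omega, wb, fun y hy hyc => ?_⟩
        have := hup y hy
        rw [hrc, inner_add_left] at hyc
        rw [hrb]; push_cast at *; linarith

lemma w_bwdB {a b : EucV 2} (h : Submodule.span ℝ {a, b} = ⊤) {S : Set (EucV 2)}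
    (hS : S ⊆ {a, b, a + b, (2 : ℝ) • a + b}) (hab : a ∈ S ∨ b ∈ S) :
    WCompat Set.univ {a, b, a + b, (2 : ℝ) • a + b} {a, b} S := by
  intro A hA hAD r hr α hα n
  have hra : r a = 1 := w_simple_one hA hAD hr (by simp) (by simp)
  have hrb : r b = 1 := w_simple_one hA hAD hr (by simp) (by simp)
  have hk : ∃ k, r (a + b) = k := ⟨_, rfl⟩
  obtain ⟨k, hrc⟩ := hk
  have hl : ∃ l, r ((2 : ℝ) • a + b) = l := ⟨_, rfl⟩
  obtain ⟨l, hrd⟩ := hl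
  have hup : ∀ x ∈ upperClos {a, b, a + b, (2 : ℝ) • a + b} A r,
      0 < ⟪a, x⟫_ℝ ∧ ⟪a, x⟫_ℝ ≤ 1 ∧
      0 < ⟪b, x⟫_ℝ ∧ ⟪b, x⟫_ℝ ≤ 1 ∧ k - 1 < ⟪a, x⟫_ℝ + ⟪b, x⟫_ℝ ∧
      ⟪a, x⟫_ℝ + ⟪b, x⟫_ℝ ≤ k ∧ l - 1 < 2 * ⟪a, x⟫_ℝ + ⟪b, x⟫_ℝ ∧
      2 * ⟪a, x⟫_ℝ + ⟪b, x⟫_ℝ ≤ l := by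
    intro x hx
    have a1 := hx.2 a (by simp)
    have a2 := w_closure_le hr hx.1 (γ := a) (by simp)
    have b1 := hx.2 b (by simp)
    have b2 := w_closure_le hr hx.1 (γ := b) (by simp)
    have c1 := hx.2 (a + b) (by simp)
    have c2 := w_closure_le hr hx.1 (γ := a + b) (by simp)
    have d1 := hx.2 ((2 : ℝ) • a + b) (by simp)
    have d2 := w_closure_le hr hx.1 (γ := (2 : ℝ) • a + b) (by simp)
    rw [hra] at a1 a2
    rw [hrb] at b1 b2
    rw [hrc, inner_add_left] at c1 c2
    rw [hrd, inner_add_left, real_inner_smul_left] at d1 d2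
    push_cast at a1 a2 b1 b2
    exact ⟨by linarith, a2, by linarith, b2, c1, c2, d1, d2⟩
  have hkl : (k = 1 ∧ l = 1) ∨ (k = 1 ∧ l = 2) ∨ (k = 2 ∧ l = 2) ∨ (k = 2 ∧ l = 3) := by
    obtain ⟨x, hx, hAx⟩ := id hA
    have hxA : x ∈ A := by rw [hAx]; exact mem_connectedComponentIn hx
    have h1 := hr a (by simp) x hxA
    have h2 := hr b (by simp) x hxA
    have h3 := hr (a + b) (by simp) x hxA
    have h3' := hr ((2 : ℝ) • a + b) (by simp) x hxA
    rw [hra] at h1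
    rw [hrb] at h2
    rw [hrc, inner_add_left] at h3
    rw [hrd, inner_add_left, real_inner_smul_left] at h3'
    push_cast at h1 h2
    have h4 : ((0:ℤ):ℝ) < k := by push_cast; linarith
    have h5 : (k:ℝ) < (3:ℤ) := by push_cast; linarith
    have h6 : ((k-1:ℤ):ℝ) < l := by push_cast; linarith
    have h7 : (l:ℝ) < ((k+2:ℤ):ℝ) := by push_cast; linarith
    have h4 := Int.cast_lt.mp h4
    have h5 := Int.cast_lt.mp h5
    have h6 := Int.cast_lt.mp h6
    have h7 := Int.cast_lt.mp h7
    omega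
  have W := w_wallB h hA hr k l hra hrb hrc hrd
  apply w_red hr (hS hα) n
  intro _ x hx hxα
  have hux := hup x hx
  rcases hkl with ⟨rfl, rfl⟩ | ⟨rfl, rfl⟩ | ⟨rfl, rfl⟩ | ⟨rfl, rfl⟩
  · rcases hS hα with rfl | rfl | rfl | rfl
    · exfalso; rw [hra] at hxα; push_cast at *; linarith
    · exfalso; rw [hrb] at hxα; push_cast at *; linarith
    · exfalso; rw [hrc, inner_add_left] at hxα; push_cast at *; linarith
    · refine ⟨_, hα, by omega, ?_, fun _ _ h => h⟩
      rw [hrd]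
      exact W _ 2 1 (by simp) (by simp) _ (1/2) 0 0 1 (by simp) (by simp) (by simp)
        (by norm_num) (by norm_num)
  · rcases hS hα with rfl | rfl | rfl | rfl
    · exfalso; rw [hra] at hxα; push_cast at *; linarith
    · exfalso; rw [hrb] at hxα; push_cast at *; linarith
    · refine ⟨_, hα, by omega, ?_, fun _ _ h => h⟩
      rw [hrc]
      exact W _ 1 1 (by simp) (by simp) _ 1 0 0 1 (by simp) (by simp) (by simp)
        (by norm_num) (by norm_num)
    · exfalso; rw [hrd, inner_add_left, real_inner_smul_left] at hxα; push_cast at *; linarith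
  · rcases hS hα with rfl | rfl | rfl | rfl
    · exfalso; rw [hra] at hxα; push_cast at *; linarith
    · refine ⟨_, hα, by omega, ?_, fun _ _ h => h⟩
      rw [hrb]
      exact W _ 0 1 (by simp) (by simp) _ 0 1 (1/2) 1 (by simp) (by simp) (by simp)
        (by norm_num) (by norm_num)
    · exfalso; rw [hrc, inner_add_left] at hxα; push_cast at *; linarith
    · refine ⟨_, hα, by omega, ?_, fun _ _ h => h⟩
      rw [hrd]
      exact W _ 2 1 (by simp) (by simp) _ 1 0 (1/2) 1 (by simp) (by simp) (by norm_num)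
        (by norm_num) (by norm_num)
  · have wa : IsWall Set.univ a (r a) A := by
      rw [hra]
      exact W _ 1 0 (by simp) (by simp) _ 1 0 1 1 (by simp) (by simp) (by simp)
        (by norm_num) (by norm_num)
    have wb : IsWall Set.univ b (r b) A := by
      rw [hrb]
      exact W _ 0 1 (by simp) (by simp) _ (1/2) 1 1 1 (by norm_num) (by simp) (by simp)
        (by norm_num) (by norm_num)
    rcases hS hα with rfl | rfl | rfl | rfl
    · exact ⟨_, hα, by omega, wa, fun _ _ h => h⟩
    · exact ⟨_, hα, by omega, wb, fun _ _ h => h⟩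
    · rcases hab with hs | hs
      · refine ⟨_, hs, by omega, wa, fun y hy hyc => ?_⟩
        have := hup y hy
        rw [hrc, inner_add_left] at hyc
        rw [hra]; push_cast at *; linarith
      · refine ⟨_, hs, by omega, wb, fun y hy hyc => ?_⟩
        have := hup y hy
        rw [hrc, inner_add_left] at hyc
        rw [hrb]; push_cast at *; linarith
    · rcases hab with hs | hs
      · refine ⟨_, hs, by omega, wa, fun y hy hyc => ?_⟩
        have := hup y hy
        rw [hrd, inner_add_left, real_inner_smul_left] at hyc
        rw [hra]; push_cast at *; linarith
      · refine ⟨_, hs, by omega, wb, fun y hy hyc => ?_⟩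
        have := hup y hy
        rw [hrd, inner_add_left, real_inner_smul_left] at hyc
        rw [hrb]; push_cast at *; linarith

/-- Common forward direction. -/
lemma w_fwd {a b : EucV 2} (h : Submodule.span ℝ {a, b} = ⊤) {P S : Set (EucV 2)}
    (haP : a ∈ P) (hbP : b ∈ P)
    (hP : ∀ γ ∈ P, γ = a ∨ γ = b ∨ γ = a + b ∨ γ = (2 : ℝ) • a + b)
    (hS : S ⊆ P) (hne : S.Nonempty) (ha : a ∉ S) (hb : b ∉ S) :
    ¬ WCompat Set.univ P {a, b} S := by
  intro hW
  obtain ⟨x, hx1, hx2⟩ := w_surjcoord h (7/8) (7/8)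
  obtain ⟨y, hy1, hy2⟩ := w_surjcoord h 1 1
  have ea : ⌈⟪a, x⟫_ℝ⌉ = 1 := by rw [hx1, Int.ceil_eq_iff]; norm_num
  have eb : ⌈⟪b, x⟫_ℝ⌉ = 1 := by rw [hx2, Int.ceil_eq_iff]; norm_num
  have ec : ⌈⟪a + b, x⟫_ℝ⌉ = 2 := by
    rw [inner_add_left, hx1, hx2, Int.ceil_eq_iff]; norm_num
  have ed : ⌈⟪(2 : ℝ) • a + b, x⟫_ℝ⌉ = 3 := by
    rw [inner_add_left, real_inner_smul_left, hx1, hx2, Int.ceil_eq_iff]; norm_num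
  have hyP : ∀ γ ∈ P, ⟪γ, y⟫_ℝ = (⌈⟪γ, x⟫_ℝ⌉ : ℝ) := by
    intro γ hγ
    rcases hP γ hγ with rfl | rfl | rfl | rfl
    · rw [ea, hy1]; norm_num
    · rw [eb, hy2]; norm_num
    · rw [ec, inner_add_left, hy1, hy2]; norm_num
    · rw [ed, inner_add_left, real_inner_smul_left, hy1, hy2]; norm_num
  have hxP : ∀ γ ∈ P, ⟪γ, x⟫_ℝ < (⌈⟪γ, x⟫_ℝ⌉ : ℝ) := by
    intro γ hγ
    rcases hP γ hγ with rfl | rfl | rfl | rfl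
    · rw [ea, hx1]; norm_num
    · rw [eb, hx2]; norm_num
    · rw [ec, inner_add_left, hx1, hx2]; norm_num
    · rw [ed, inner_add_left, real_inner_smul_left, hx1, hx2]; norm_num
  have hx : x ∈ Set.univ \ hypUnion Set.univ P := by
    refine ⟨trivial, ?_⟩
    rintro ⟨_, γ, hγ, n, hn⟩
    have := hxP γ hγ
    rw [hn] at this
    simp at this
  have hr := w_address hx
  have hA : IsAlcove Set.univ P (connectedComponentIn (Set.univ \ hypUnion Set.univ P) x) :=
    ⟨x, hx, rfl⟩
  generalize connectedComponentIn (Set.univ \ hypUnion Set.univ P) x = A at hr hA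
  have hAD : A ⊆ fundPar Set.univ {a, b} := by
    intro z hz
    refine ⟨trivial, ?_⟩
    rintro c (rfl | hc)
    · have := hr c haP z hz
      simp only [ea] at this
      push_cast at this
      constructor <;> linarith
    · rw [Set.mem_singleton_iff] at hc
      subst hc
      have := hr c hbP z hz
      simp only [eb] at this
      push_cast at this
      constructor <;> linarith
  have hyA : y ∈ upperClos P A (fun γ => ⌈⟪γ, x⟫_ℝ⌉) := by
    constructor
    · apply w_mem_closure hA hr
      intro γ hγ
      rw [hyP γ hγ]
      constructor <;> simp
    · intro γ hγ
      rw [hyP γ hγ]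
      simp
  obtain ⟨α, hα⟩ := hne
  rcases hW A hA hAD _ hr α hα ⌈⟪α, x⟫_ℝ⌉ with hemp | ⟨β, hβ, m, hm, _, hw, -⟩
  · have : y ∈ (∅ : Set (EucV 2)) := hemp ▸ ⟨hyA, hyP α (hS hα)⟩
    exact this
  · obtain ⟨z, hz1, hz2⟩ := w_surjcoord h 0 m
    have hsub : ({x ∈ Set.univ | ⟪β, x⟫_ℝ = (m : ℝ)} ∩ closure A) ⊆ {y} := by
      rintro q ⟨⟨_, hq⟩, hqA⟩
      have q1 := w_closure_le hr hqA haP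
      have q2 := w_closure_le hr hqA hbP
      simp only [ea, eb] at q1 q2
      push_cast at q1 q2
      rw [hm] at hq
      rw [Set.mem_singleton_iff]
      rcases hP β (hS hβ) with rfl | rfl | rfl | rfl
      · exact absurd hβ ha
      · exact absurd hβ hb
      · rw [ec, inner_add_left] at hq
        push_cast at hq
        exact w_injcoord h (by linarith) (by linarith)
      · rw [ed, inner_add_left, real_inner_smul_left] at hq
        push_cast at hq
        exact w_injcoord h (by linarith) (by linarith)
    have hzm : ⟪β, z⟫_ℝ = m := by
      rcases hP β (hS hβ) with rfl | rfl | rfl | rfl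
      · exact absurd hβ ha
      · exact absurd hβ hb
      · rw [inner_add_left, hz1, hz2]; ring
      · rw [inner_add_left, real_inner_smul_left, hz1, hz2]; ring
    have hz := affineSpan_mono ℝ hsub (hw z trivial hzm)
    rw [AffineSubspace.mem_affineSpan_singleton] at hz
    rw [hz, hy1] at hz1
    norm_num at hz1

lemma w_comb {a b γ : EucV 2} (h : IsNNIntComb {a, b} γ) :
    ∃ i j : ℕ, γ = (i : ℝ) • a + (j : ℝ) • b := by
  obtain ⟨s, c, hs, rfl⟩ := h
  induction s using Finset.induction_on with
  | empty => exact ⟨0, 0, by simp⟩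
  | insert x s hx ih =>
    rw [Finset.coe_insert, Set.insert_subset_iff] at hs
    obtain ⟨i, j, hij⟩ := ih hs.2
    rw [Finset.sum_insert hx, hij]
    rcases hs.1 with rfl | h1
    · refine ⟨i + c x, j, ?_⟩
      push_cast
      module
    · rw [Set.mem_singleton_iff] at h1
      subst h1
      refine ⟨i, j + c x, ?_⟩
      push_cast
      module

lemma w_comb_mk {a b : EucV 2} (hab : a ≠ b) (i j : ℕ) :
    IsNNIntComb {a, b} ((i : ℝ) • a + (j : ℝ) • b) := by
  classical
  refine ⟨{a, b}, fun x => if x = a then i else j, by simp, ?_⟩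
  rw [Finset.sum_pair hab]
  simp [hab.symm]

lemma w_delta (rs : RootSystemData 2) : ∃ a b, a ≠ b ∧ rs.Δ = {a, b} ∧
    Submodule.span ℝ {a, b} = ⊤ ∧ (∀ s t : ℝ, s • a + t • b = 0 → s = 0 ∧ t = 0) := by
  have hspan : Submodule.span ℝ rs.Δ = ⊤ := by
    rw [eq_top_iff, ← rs.spanning, Submodule.span_le]
    have hm : ∀ γ, IsNNIntComb rs.Δ γ → γ ∈ Submodule.span ℝ rs.Δ := by
      rintro γ ⟨s, c, hs, rfl⟩
      exact Submodule.sum_mem _ fun x hx =>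
        Submodule.smul_mem _ _ (Submodule.subset_span (hs hx))
    intro γ hγ
    rcases rs.pos_or_neg γ hγ with h | h
    · exact hm _ h
    · simpa using Submodule.neg_mem _ (hm _ h)
  have hfin : rs.Δ.Finite := rs.finite.subset rs.simple_sub
  have hcard : rs.Δ.ncard = 2 := by
    haveI := hfin.fintype
    have h1 := finrank_span_set_eq_card (R := ℝ) (s := rs.Δ) rs.simple_indep
    rw [hspan, finrank_top] at h1
    rw [Set.ncard_eq_toFinset_card', ← h1]
    simp
  obtain ⟨a, b, hab, hΔ⟩ := Set.ncard_eq_two.mp hcard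
  refine ⟨a, b, hab, hΔ, hΔ ▸ hspan, ?_⟩
  have hi : LinearIndepOn ℝ id rs.Δ := rs.simple_indep
  rw [hΔ, LinearIndepOn.pair_iff _ hab] at hi
  exact hi

lemma w_class (rs : RootSystemData 2) (a b : EucV 2) (hΔ : rs.Δ = {a, b}) (hab : a ≠ b)
    (hind : ∀ s t : ℝ, s • a + t • b = 0 → s = 0 ∧ t = 0) (p q : ℤ)
    (hp : 2 * ⟪b, a⟫_ℝ = ((-p : ℤ) : ℝ) * ⟪a, a⟫_ℝ)
    (hq : 2 * ⟪a, b⟫_ℝ = ((-q : ℤ) : ℝ) * ⟪b, b⟫_ℝ)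
    (hcard : rs.Pos.ncard ≤ 4) :
    0 ≤ p ∧ (p = 0 → q = 0 → ¬ IrredSet rs.Φ) ∧
    (p = 1 → q = 1 → rs.Pos = {a, b, a + b}) ∧
    (p = 2 → q = 1 → rs.Pos = {a, b, a + b, (2 : ℝ) • a + b}) ∧ ¬ (p = 3 ∧ q = 1) := by
  have ha : a ∈ rs.Φ := rs.simple_sub (by rw [hΔ]; simp)
  have hb : b ∈ rs.Φ := rs.simple_sub (by rw [hΔ]; simp)
  have ha0 : a ≠ 0 := fun h => rs.nonzero (h ▸ ha)
  have hb0 : b ≠ 0 := fun h => rs.nonzero (h ▸ hb)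
  have haa : ⟪a, a⟫_ℝ ≠ 0 := fun h => ha0 (inner_self_eq_zero.mp h)
  have hbb : ⟪b, b⟫_ℝ ≠ 0 := fun h => hb0 (inner_self_eq_zero.mp h)
  have hinj : ∀ i j k l : ℤ, (i : ℝ) • a + (j : ℝ) • b = (k : ℝ) • a + (l : ℝ) • b →
      i = k ∧ j = l := by
    intro i j k l h
    have h1 : ((i : ℝ) - k) • a + ((j : ℝ) - l) • b = 0 := by
      have := sub_eq_zero.mpr h
      rw [← this]; module
    have := hind _ _ h1
    exact ⟨by exact_mod_cast sub_eq_zero.mp this.1, by exact_mod_cast sub_eq_zero.mp this.2⟩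
  have ⟨R, hR⟩ : ∃ R : ℤ → ℤ → Prop, ∀ i j, R i j ↔ (i : ℝ) • a + (j : ℝ) • b ∈ rs.Φ :=
    ⟨_, fun _ _ => Iff.rfl⟩
  have R10 : R 1 0 := by rw [hR]; simpa using ha
  have R01 : R 0 1 := by rw [hR]; simpa using hb
  have Rsign : ∀ i j, R i j → (0 ≤ i ∧ 0 ≤ j) ∨ (i ≤ 0 ∧ j ≤ 0) := by
    intro i j h
    rw [hR] at h
    rcases rs.pos_or_neg _ h with h | h
    · rw [hΔ] at h
      obtain ⟨k, l, hkl⟩ := w_comb h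
      have := hinj i j k l (by exact_mod_cast hkl)
      omega
    · rw [hΔ] at h
      obtain ⟨k, l, hkl⟩ := w_comb h
      have := hinj (-i) (-j) k l (by push_cast; rw [← hkl]; module)
      omega
  have Ra : ∀ i j, R i j → R (p * j - i) j := by
    intro i j h
    rw [hR] at h ⊢
    have h1 := rs.refl_mem a ha _ h
    have h2 : 2 * ⟪(i : ℝ) • a + (j : ℝ) • b, a⟫_ℝ / ⟪a, a⟫_ℝ = 2 * i - p * j := by
      rw [div_eq_iff haa, inner_add_left, real_inner_smul_left, real_inner_smul_left]
      push_cast at hp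
      linear_combination (j : ℝ) * hp
    rw [h2] at h1
    convert h1 using 1
    push_cast
    module
  have Rb : ∀ i j, R i j → R i (q * i - j) := by
    intro i j h
    rw [hR] at h ⊢
    have h1 := rs.refl_mem b hb _ h
    have h2 : 2 * ⟪(i : ℝ) • a + (j : ℝ) • b, b⟫_ℝ / ⟪b, b⟫_ℝ = 2 * j - q * i := by
      rw [div_eq_iff hbb, inner_add_left, real_inner_smul_left, real_inner_smul_left]
      push_cast at hq
      linear_combination (i : ℝ) * hq
    rw [h2] at h1
    convert h1 using 1
    push_cast
    module
  have Rred : ∀ k i j, R i j → R (k * i) (k * j) → k = 1 ∨ k = -1 := by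
    intro k i j h h'
    rw [hR] at h h'
    have := rs.reduced _ h (k : ℝ) (by convert h' using 1; push_cast; module)
    exact_mod_cast this
  have Rneg : ∀ i j, R i j → R (-i) (-j) := by
    intro i j h
    rw [hR] at h ⊢
    convert rs.neg_mem _ h using 1
    push_cast
    module
  have hΦ : ∀ γ ∈ rs.Φ, ∃ i j : ℤ, R i j ∧ γ = (i : ℝ) • a + (j : ℝ) • b := by
    intro γ hγ
    rcases rs.pos_or_neg _ hγ with h | h
    · rw [hΔ] at h
      obtain ⟨k, l, hkl⟩ := w_comb h
      refine ⟨k, l, ?_, by exact_mod_cast hkl⟩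
      rw [hR]
      push_cast
      rw [← hkl]; exact hγ
    · rw [hΔ] at h
      obtain ⟨k, l, hkl⟩ := w_comb h
      have e : γ = ((-k : ℤ) : ℝ) • a + ((-l : ℤ) : ℝ) • b := by
        rw [← neg_neg γ, hkl]; push_cast; module
      refine ⟨-k, -l, ?_, e⟩
      rw [hR]
      rw [← e]; exact hγ
  have hPos : ∀ γ, γ ∈ rs.Pos ↔
      ∃ i j : ℤ, 0 ≤ i ∧ 0 ≤ j ∧ R i j ∧ γ = (i : ℝ) • a + (j : ℝ) • b := by
    intro γ
    constructor
    · rintro ⟨h1, h2⟩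
      rw [hΔ] at h2
      obtain ⟨k, l, hkl⟩ := w_comb h2
      refine ⟨k, l, by positivity, by positivity, ?_, by exact_mod_cast hkl⟩
      rw [hR]
      push_cast
      rw [← hkl]; exact h1
    · rintro ⟨i, j, hi, hj, hij, rfl⟩
      refine ⟨(hR _ _).mp hij, ?_⟩
      rw [hΔ]
      lift i to ℕ using hi
      lift j to ℕ using hj
      exact_mod_cast w_comb_mk hab i j
  have Ri0 : ∀ i, 0 ≤ i → R i 0 → i = 1 := by
    intro i hi h
    have := Rred i 1 0 R10 (by simpa using h)
    omega
  have R0j : ∀ j, 0 ≤ j → R 0 j → j = 1 := by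
    intro i hi h
    have := Rred i 0 1 R01 (by simpa using h)
    omega
  refine ⟨?_, ?_, ?_, ?_, ?_⟩
  · have := Rsign _ _ (Ra _ _ R01)
    omega
  · intro hp0 hq0 hirr
    subst hp0
    subst hq0
    have hin : ⟪a, b⟫_ℝ = 0 := by simpa using hq
    apply hirr
    refine ⟨{c ∈ rs.Φ | ∃ i : ℤ, c = (i : ℝ) • a}, {c ∈ rs.Φ | ∃ i : ℤ, c = (i : ℝ) • b},
      ⟨a, ha, 1, by simp⟩, ⟨b, hb, 1, by simp⟩, ?_, ?_⟩
    · ext γ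
      constructor
      · intro hγ
        obtain ⟨i, j, hij, e⟩ := hΦ γ hγ
        have s1 := Rsign _ _ hij
        have s2 := Rsign _ _ (Ra _ _ hij)
        have : j = 0 ∨ i = 0 := by omega
        rcases this with rfl | rfl
        · left; exact ⟨hγ, i, by simpa using e⟩
        · right; exact ⟨hγ, j, by simpa using e⟩
      · rintro (h | h)
        · exact h.1
        · exact h.1
    · rintro _ ⟨_, i, rfl⟩ _ ⟨_, j, rfl⟩
      rw [real_inner_smul_left, real_inner_smul_right, hin]; simp
  · rintro rfl rfl
    ext γ
    rw [hPos]
    simp only [Set.mem_insert_iff, Set.mem_singleton_iff]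
    constructor
    · rintro ⟨i, j, hi, hj, hij, rfl⟩
      have s1 := Rsign _ _ (Ra _ _ hij)
      have s2 := Rsign _ _ (Rb _ _ hij)
      have : j = 0 ∨ i = 0 ∨ i = j := by omega
      rcases this with rfl | rfl | rfl
      · obtain rfl := Ri0 i hi hij
        left; simp
      · obtain rfl := R0j j hj hij
        right; left; simp
      · have R11 : R 1 1 := by simpa using Ra _ _ R01
        have := Rred i 1 1 R11 (by simpa using hij)
        have : i = 1 := by omega
        subst this
        right; right; simp
    · rintro (rfl | rfl | rfl)
      · exact ⟨1, 0, by simp, by simp, R10, by simp⟩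
      · exact ⟨0, 1, by simp, by simp, R01, by simp⟩
      · exact ⟨1, 1, by simp, by simp, by simpa using Ra _ _ R01, by simp⟩
  · rintro rfl rfl
    have R11 : R 1 1 := by simpa using Rb _ _ R10
    have R21 : R 2 1 := by simpa using Ra _ _ R01
    ext γ
    rw [hPos]
    simp only [Set.mem_insert_iff, Set.mem_singleton_iff]
    constructor
    · rintro ⟨i, j, hi, hj, hij, rfl⟩
      have s1 := Rsign _ _ (Ra _ _ hij)
      have s2 := Rsign _ _ (Rb _ _ hij)
      have s3 := Rsign _ _ (Ra _ _ (Rb _ _ hij))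
      have : j = 0 ∨ i = 0 ∨ i = j ∨ i = 2 * j := by omega
      rcases this with rfl | rfl | rfl | rfl
      · obtain rfl := Ri0 i hi hij
        left; simp
      · obtain rfl := R0j j hj hij
        right; left; simp
      · have := Rred i 1 1 R11 (by simpa using hij)
        have : i = 1 := by omega
        subst this
        right; right; left; simp
      · have := Rred j 2 1 R21 (by rw [mul_comm j 2]; simpa using hij)
        have : j = 1 := by omega
        subst this
        right; right; right; simp
    · rintro (rfl | rfl | rfl | rfl)
      · exact ⟨1, 0, by simp, by simp, R10, by simp⟩
      · exact ⟨0, 1, by simp, by simp, R01, by simp⟩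
      · exact ⟨1, 1, by simp, by simp, R11, by simp⟩
      · exact ⟨2, 1, by simp, by simp, R21, by simp⟩
  · rintro ⟨rfl, rfl⟩
    have R11 : R 1 1 := by simpa using Rb _ _ R10
    have R31 : R 3 1 := by simpa using Ra _ _ R01
    have R21 : R 2 1 := by simpa using Ra _ _ R11
    let T : Finset (ℤ × ℤ) := {(1, 0), (0, 1), (1, 1), (2, 1), (3, 1)}
    let f : ℤ × ℤ → EucV 2 := fun z => (z.1 : ℝ) • a + (z.2 : ℝ) • b
    have hf : Function.Injective f := fun z w h => Prod.ext_iff.mpr (hinj _ _ _ _ h)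
    have hsub : f '' (T : Set (ℤ × ℤ)) ⊆ rs.Pos := by
      rintro _ ⟨⟨i, j⟩, hz, rfl⟩
      rw [hPos]
      refine ⟨i, j, ?_⟩
      simp only [T, Finset.coe_insert, Finset.coe_singleton, Set.mem_insert_iff,
        Set.mem_singleton_iff, Prod.mk.injEq] at hz
      rcases hz with ⟨rfl, rfl⟩ | ⟨rfl, rfl⟩ | ⟨rfl, rfl⟩ | ⟨rfl, rfl⟩ | ⟨rfl, rfl⟩
      · exact ⟨by simp, by simp, R10, rfl⟩
      · exact ⟨by simp, by simp, R01, rfl⟩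
      · exact ⟨by simp, by simp, R11, rfl⟩
      · exact ⟨by simp, by simp, R21, rfl⟩
      · exact ⟨by simp, by simp, R31, rfl⟩
    have h1 := Set.ncard_le_ncard hsub (rs.finite.subset fun x hx => hx.1)
    rw [Set.ncard_image_of_injective _ hf, Set.ncard_coe_finset] at h1
    have h2 : T.card = 5 := by decide
    omega

lemma w_type (rs : RootSystemData 2) (hirr : IrredSet rs.Φ) (hcard : rs.Pos.ncard ≤ 4) :
    ∃ a b, Submodule.span ℝ {a, b} = ⊤ ∧ rs.Δ = {a, b} ∧
      (rs.Pos = {a, b, a + b} ∨ rs.Pos = {a, b, a + b, (2 : ℝ) • a + b}) := by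
  obtain ⟨a, b, hab, hΔ, hspan, hind⟩ := w_delta rs
  have ha : a ∈ rs.Φ := rs.simple_sub (by rw [hΔ]; simp)
  have hb : b ∈ rs.Φ := rs.simple_sub (by rw [hΔ]; simp)
  have ha0 : a ≠ 0 := fun h => rs.nonzero (h ▸ ha)
  have hb0 : b ≠ 0 := fun h => rs.nonzero (h ▸ hb)
  have haa : 0 < ⟪a, a⟫_ℝ := real_inner_self_pos.mpr ha0
  have hbb : 0 < ⟪b, b⟫_ℝ := real_inner_self_pos.mpr hb0
  obtain ⟨p, hp⟩ := rs.cryst a ha b hb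
  obtain ⟨q, hq⟩ := rs.cryst b hb a ha
  obtain ⟨p, rfl⟩ : ∃ p', p = -p' := ⟨-p, by simp⟩
  obtain ⟨q, rfl⟩ : ∃ p', q = -p' := ⟨-q, by simp⟩
  have hΔ' : rs.Δ = {b, a} := by rw [hΔ, Set.pair_comm]
  have hspan' : Submodule.span ℝ {b, a} = ⊤ := by rw [Set.pair_comm, hspan]
  have hind' : ∀ s t : ℝ, s • b + t • a = 0 → s = 0 ∧ t = 0 := by
    intro s t h
    rw [add_comm] at h
    exact (hind t s h).symm
  obtain ⟨p0, c0, c1, c2, c3⟩ := w_class rs a b hΔ hab hind p q hp hq hcard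
  obtain ⟨q0, -, -, d2, d3⟩ := w_class rs b a hΔ' hab.symm hind' q p hq hp hcard
  have hcomm : ⟪b, a⟫_ℝ = ⟪a, b⟫_ℝ := real_inner_comm _ _
  rw [hcomm] at hp
  push_cast at hp hq
  have hpq0 : p = 0 ↔ q = 0 := by
    constructor
    · rintro rfl
      have : (q : ℝ) * ⟪b, b⟫_ℝ = 0 := by push_cast at hp; linarith
      rcases mul_eq_zero.mp this with h | h
      · exact_mod_cast h
      · exact absurd h hbb.ne'
    · rintro rfl
      have : (p : ℝ) * ⟪a, a⟫_ℝ = 0 := by push_cast at hq; linarith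
      rcases mul_eq_zero.mp this with h | h
      · exact_mod_cast h
      · exact absurd h haa.ne'
  have hpq : p * q < 4 := by
    have hw : ⟪b, b⟫_ℝ • a + (-⟪a, b⟫_ℝ) • b ≠ 0 := fun h => hbb.ne' (hind _ _ h).1
    have hw' := real_inner_self_pos.mpr hw
    simp only [inner_add_left, inner_add_right, real_inner_smul_left, real_inner_smul_right,
      hcomm] at hw'
    have e : 4 * (⟪a, b⟫_ℝ * ⟪a, b⟫_ℝ) = p * q * (⟪a, a⟫_ℝ * ⟪b, b⟫_ℝ) := by
      linear_combination (2 * ⟪a, b⟫_ℝ) * hp - (p * ⟪a, a⟫_ℝ) * hq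
    generalize ⟪a, a⟫_ℝ = x at *
    generalize ⟪b, b⟫_ℝ = y at *
    generalize ⟪a, b⟫_ℝ = z at *
    have h1 : 0 < y * (x * y - z * z) := by linarith
    have h2 : 0 < x * y - z * z := pos_of_mul_pos_right h1 hbb.le
    have h3 : 0 < (4 - (p * q : ℝ)) * (x * y) := by linarith
    have h4 := pos_of_mul_pos_left h3 (mul_pos haa hbb).le
    have : ((p * q : ℤ) : ℝ) < (4 : ℤ) := by push_cast; linarith
    exact_mod_cast this
  by_cases hz : p = 0
  · exact absurd hirr (c0 hz (hpq0.mp hz))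
  have hq1 : q ≠ 0 := fun h => hz (hpq0.mpr h)
  have hp3 : p ≤ 3 := by
    have : 1 ≤ q := by omega
    nlinarith
  have hq3 : q ≤ 3 := by
    have : 1 ≤ p := by omega
    nlinarith
  have hcases : (p = 1 ∧ q = 1) ∨ (p = 2 ∧ q = 1) ∨ (p = 3 ∧ q = 1) ∨
      (q = 2 ∧ p = 1) ∨ (q = 3 ∧ p = 1) := by
    have : 1 ≤ p := by omega
    have : 1 ≤ q := by omega
    interval_cases p <;> interval_cases q <;> omega
  rcases hcases with h | h | h | h | h
  · exact ⟨a, b, hspan, hΔ, Or.inl (c1 h.1 h.2)⟩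
  · exact ⟨a, b, hspan, hΔ, Or.inr (c2 h.1 h.2)⟩
  · exact absurd h c3
  · exact ⟨b, a, hspan', hΔ', Or.inr (d2 h.1 h.2)⟩
  · exact absurd h d3

/-- Let `Φ` be an irreducible crystallographic root system of rank 2 of type `A₂`
or `B₂` (i.e. `|Φ⁺| ∈ {3,4}`). A subset `Σ ⊆ Φ⁺` is Worpitzky-compatible iff
`Σ = ∅` or `Σ` contains a simple root. -/
theorem rank_two_worpitzky_compatible_iff_simple
    (rs : RootSystemData 2) (hirr : IrredSet rs.Φ)
    (hcard : rs.Pos.ncard = 3 ∨ rs.Pos.ncard = 4)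
    (S : Set (EucV 2)) (hS : S ⊆ rs.Pos) :
    WCompat Set.univ rs.Pos rs.Δ S ↔ (S = ∅ ∨ (S ∩ rs.Δ).Nonempty) := by
  obtain ⟨a, b, hspan, hΔ, hP⟩ := w_type rs hirr (by omega)
  rw [hΔ]
  constructor
  · intro hW
    by_contra! hcon
    obtain ⟨h1, h2⟩ := hcon
    have ha : a ∉ S := fun h => by
      have : a ∈ (∅ : Set (EucV 2)) := h2 ▸ ⟨h, by simp⟩
      exact this
    have hb : b ∉ S := fun h => by
      have : b ∈ (∅ : Set (EucV 2)) := h2 ▸ ⟨h, by simp⟩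
      exact this
    refine w_fwd hspan ?_ ?_ ?_ hS h1 ha hb hW
    · rcases hP with h | h <;> rw [h] <;> simp
    · rcases hP with h | h <;> rw [h] <;> simp
    · intro γ hγ
      rcases hP with h | h
      · rw [h] at hγ
        rcases hγ with h | h | h <;> simp_all
      · rw [h] at hγ
        rcases hγ with h | h | h | h <;> simp_all
  · rintro (rfl | ⟨c, hc, hcD⟩)
    · intro A _ _ r _ α hα
      exact absurd hα (Set.notMem_empty α)
    · have hab : a ∈ S ∨ b ∈ S := by
        rcases hcD with rfl | h
        · exact Or.inl hc
        · rw [Set.mem_singleton_iff] at h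
          exact Or.inr (h ▸ hc)
      rcases hP with h | h
      · rw [h] at hS ⊢
        exact w_bwdA hspan hS hab
      · rw [h] at hS ⊢
        exact w_bwdB hspan hS hab

end
end
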